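/- Let S_1 and S_2 be iterated sequences for Gr(3,6), with Gr(3,6)-iteration triples ((i_1,6),(i_2,6),(i_3,6)) resp. ((i_1',6),(i_2',6),(i_3',6)) and Gr(3,5)-iteration triples ((j_1,5),(j_2,5),(j_3,5)) resp. ((j_1',5),(j_2',5),(j_3',5)). Then In_{M_{S_1}}(𝓘_{3,6}) = In_{M_{S_2}}(𝓘_{3,6}) if and only if (i_1,i_2) = (i_1',i_2') and (j_1,j_2) = (j_1',j_2'); that is, the initial ideal depends exactly on the first two indices used in each iteration. -/

import Mathlib

/-!
Common framework: iterated sequences for Gr(3,n), the matrix `A_S`, pullbacks of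
Plücker coordinates, the weighted reverse lexicographic order, lowest-term
valuations, Plücker relations, weighting matrices and initial ideals.
-/

open MvPolynomial

noncomputable section

/-- Height of a positive root `(i,j) ↦ j - i`. -/
def Ht (β : ℕ × ℕ) : ℕ := β.2 - β.1

/-- `IsIter n S` : `S` is an iterated sequence for `Gr(3,n)`: it starts (as base of the
iteration) from a PBW sequence for `Gr(3,4)`, i.e. an ordering of `((1,4),(2,4),(3,4))`,
and for each `r = 5, …, n` a triple `((i₁,r),(i₂,r),(i₃,r))` with `i₁,i₂,i₃ ∈ [r-1]`
pairwise distinct is prepended. -/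
inductive IsIter : ℕ → List (ℕ × ℕ) → Prop
  | base (L : List (ℕ × ℕ)) : L.Perm [(1,4),(2,4),(3,4)] → IsIter 4 L
  | step (r : ℕ) (L : List (ℕ × ℕ)) (i₁ i₂ i₃ : ℕ) :
      4 ≤ r → IsIter r L →
      1 ≤ i₁ → i₁ ≤ r → 1 ≤ i₂ → i₂ ≤ r → 1 ≤ i₃ → i₃ ≤ r →
      i₁ ≠ i₂ → i₁ ≠ i₃ → i₂ ≠ i₃ →
      IsIter (r+1) ((i₁, r+1) :: (i₂, r+1) :: (i₃, r+1) :: L)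

/-- `Sorted k n I` : `I ∈ I_{k,n}`, a strictly increasing `k`-tuple in `{1,…,n}`. -/
def Sorted (k n : ℕ) (I : Fin k → ℕ) : Prop :=
  StrictMono I ∧ ∀ a, 1 ≤ I a ∧ I a ≤ n

/-- `ℕ`-indexed square "matrices" (1-based indexing, size given by a parameter `n`). -/
abbrev NMat := ℕ → ℕ → MvPolynomial (ℕ × ℕ) ℂ

/-- Product of two `n × n` matrices, 1-based indexing. -/
def matMul (n : ℕ) (A B : NMat) : NMat := fun i j => ∑ k ∈ Finset.Icc 1 n, A i k * B k j

/-- Identity matrix. -/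
def idN : NMat := fun i j => if i = j then 1 else 0

/-- The factor `1 + x_β f_β`, where `f_β` is the matrix unit in entry `β = (i,j)`. -/
def factor (β : ℕ × ℕ) : NMat := fun i j =>
  (if i = j then (1 : MvPolynomial (ℕ × ℕ) ℂ) else 0) +
    (if i = β.1 ∧ j = β.2 then (MvPolynomial.X β : MvPolynomial (ℕ × ℕ) ℂ) else 0)

/-- `A_S := (1 + x_{β_N} f_{β_N}) ⋯ (1 + x_{β_1} f_{β_1})` for `S = (β_1, …, β_N)`. -/
def ASmat (n : ℕ) : List (ℕ × ℕ) → NMat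
  | [] => idN
  | β :: L => matMul n (ASmat n L) (factor β)

/-- `φ_S^*(p̄_I)` : the determinant of the `3×3` submatrix of `A_S` on rows `(1,2,3)`
and columns `I = (i₁,i₂,i₃)`. -/
def phiStar (n : ℕ) (S : List (ℕ × ℕ)) (I : Fin 3 → ℕ) : MvPolynomial (ℕ × ℕ) ℂ :=
  Matrix.det (Matrix.of fun a b : Fin 3 => ASmat n S (a.val + 1) (I b))

/-- `Ψ_S(a) = Σ_l a_l Ht(β_l)`, the height-weighted function (written on exponents). -/
def Psi (d : (ℕ × ℕ) →₀ ℕ) : ℕ := d.sum fun β c => c * Ht β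

/-- `a <_lex b` : lexicographic comparison of exponent vectors, the coordinates being
read in the order `β_1, …, β_N` of the sequence `S`. -/
def lexLT (S : List (ℕ × ℕ)) (a b : (ℕ × ℕ) →₀ ℕ) : Prop :=
  ∃ k < S.length, (∀ m < k, a (S.getD m (0,0)) = b (S.getD m (0,0))) ∧
    a (S.getD k (0,0)) < b (S.getD k (0,0))

/-- `a ≤_lex b` on coordinates indexed by `S`. -/
def lexLE (S : List (ℕ × ℕ)) (a b : (ℕ × ℕ) →₀ ℕ) : Prop :=
  lexLT S a b ∨ ∀ k < S.length, a (S.getD k (0,0)) = b (S.getD k (0,0))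

/-- `a ≺_{Ψ_S} b` : the strict `Ψ_S`-weighted reverse lexicographic order:
`Ψ_S(a) < Ψ_S(b)`, or `Ψ_S(a) = Ψ_S(b)` and `a >_lex b`. -/
def psiLT (S : List (ℕ × ℕ)) (a b : (ℕ × ℕ) →₀ ℕ) : Prop :=
  Psi a < Psi b ∨ (Psi a = Psi b ∧ lexLT S b a)

/-- `a ⪯_{Ψ_S} b`. -/
def psiLE (S : List (ℕ × ℕ)) (a b : (ℕ × ℕ) →₀ ℕ) : Prop :=
  Psi a < Psi b ∨ (Psi a = Psi b ∧ lexLE S b a)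

open scoped Classical in
/-- The `⪯_{Ψ_S}`-minimum of the support of a polynomial (defaulting to `0` if no
minimum exists). -/
def minSupp (S : List (ℕ × ℕ)) (f : MvPolynomial (ℕ × ℕ) ℂ) : (ℕ × ℕ) →₀ ℕ :=
  if h : ∃ m ∈ f.support, ∀ m' ∈ f.support, psiLE S m m' then h.choose else 0

/-- The lowest-term valuation `v_S(p̄_I)` : the `⪯_{Ψ_S}`-minimum of the support of
`φ_S^*(p̄_I)`. -/
def valS (n : ℕ) (S : List (ℕ × ℕ)) (I : Fin 3 → ℕ) : (ℕ × ℕ) →₀ ℕ :=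
  minSupp S (phiStar n S I)

/-- The index set `I_{3,n}` of Plücker variables. -/
abbrev MI (n : ℕ) := {v : Fin 3 → ℕ // Sorted 3 n v}

/-- The Plücker polynomial ring `ℂ[p_K : K ∈ I_{3,n}]`. -/
abbrev PRing (n : ℕ) := MvPolynomial (MI n) ℂ

open scoped Classical in
/-- The Plücker variable `p_K`, defined to be `0` if `K` is not strictly increasing
(in particular `p_{I ∪ j} = 0` if `j ∈ I`). -/
def pvar (n : ℕ) (K : Fin 3 → ℕ) : PRing n :=
  if h : Sorted 3 n K then MvPolynomial.X (⟨K, h⟩ : MI n) else 0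

/-- `I ∪ j` : the sorted triple obtained by adjoining `j` to the pair `I`. -/
def insert3 (I : Fin 2 → ℕ) (j : ℕ) : Fin 3 → ℕ :=
  fun a => (List.insertionSort (· ≤ ·) [I 0, I 1, j]).getD a 0

/-- `J ∖ j` : the sorted triple obtained by removing `j` from the 4-tuple `J`. -/
def erase4 (J : Fin 4 → ℕ) (j : ℕ) : Fin 3 → ℕ :=
  fun a => (([J 0, J 1, J 2, J 3]).erase j).getD a 0

/-- The Plücker relation
`R_{I,J} = Σ_{j ∈ J} (−1)^{#{i∈I : i<j} + #{j'∈J : j<j'}} p_{I∪j} p_{J∖j}`. -/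
def Rrel (n : ℕ) (I : Fin 2 → ℕ) (J : Fin 4 → ℕ) : PRing n :=
  ∑ a : Fin 4,
    (-1 : PRing n) ^ ((Finset.univ.filter fun b : Fin 2 => I b < J a).card +
        (Finset.univ.filter fun b : Fin 4 => J a < J b).card) *
      (pvar n (insert3 I (J a)) * pvar n (erase4 J (J a)))

/-- The Plücker ideal `𝓘_{3,n}`, generated by all Plücker relations. -/
def PluckerIdeal (n : ℕ) : Ideal (PRing n) :=
  Ideal.span {f | ∃ I J, Sorted 2 n I ∧ Sorted 4 n J ∧ f = Rrel n I J}

/-- `M_S · m = Σ_K m_K v_S(p̄_K)` : the weighting matrix applied to an exponent. -/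
def MSdot (n : ℕ) (S : List (ℕ × ℕ)) (m : MI n →₀ ℕ) : (ℕ × ℕ) →₀ ℕ :=
  m.sum fun K c => c • valS n S K.val

open scoped Classical in
/-- The initial form `In_{M_S}(f)` : the sum of the terms of `f` whose `M_S`-weight is
`⪯_{Ψ_S}`-minimal. -/
def inM (n : ℕ) (S : List (ℕ × ℕ)) (f : PRing n) : PRing n :=
  ∑ m ∈ f.support.filter fun m => ∀ m' ∈ f.support, psiLE S (MSdot n S m) (MSdot n S m'),
    MvPolynomial.monomial m (f.coeff m)

/-- The initial ideal `In_{M_S}(𝓘_{3,n}) = ⟨In_{M_S}(g) : g ∈ 𝓘_{3,n}, g ≠ 0⟩`. -/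
def InIdeal (n : ℕ) (S : List (ℕ × ℕ)) : Ideal (PRing n) :=
  Ideal.span {g | ∃ f, f ∈ PluckerIdeal n ∧ f ≠ 0 ∧ g = inM n S f}

/-- Evaluation of the `ℤ`-linear functional with coefficients `c` on an exponent
vector (i.e. an element `e ∈ (ℤ^{3(n-3)})^*` given by its coefficients). -/
def evalF (c : ℕ × ℕ → ℤ) (d : (ℕ × ℕ) →₀ ℕ) : ℤ := d.sum fun β m => c β * (m : ℤ)

/-- `v_S(p̄_{I∪j}) + v_S(p̄_{J∖j})`, the `M_S`-weight of the term of `R_{I,J}`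
corresponding to `j = J a`. -/
def wvec (n : ℕ) (S : List (ℕ × ℕ)) (I : Fin 2 → ℕ) (J : Fin 4 → ℕ) (a : Fin 4) :
    (ℕ × ℕ) →₀ ℕ :=
  valS n S (insert3 I (J a)) + valS n S (erase4 J (J a))

/-- A `ℤ`-linear functional `e` (given by its coefficients `c`) *preserves inequalities*
with respect to `S` if for every nonzero Plücker relation `R_{I,J}` and all
`s₁, s₂ ∈ J ∖ I`, `v_S(p̄_{I∪s₁}) + v_S(p̄_{J∖s₁}) ≺_{Ψ_S} v_S(p̄_{I∪s₂}) + v_S(p̄_{J∖s₂})`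
implies the corresponding strict inequality of the values of `e`. -/
def PreservesIneq (n : ℕ) (S : List (ℕ × ℕ)) (c : ℕ × ℕ → ℤ) : Prop :=
  ∀ (I : Fin 2 → ℕ) (J : Fin 4 → ℕ), Sorted 2 n I → Sorted 4 n J → Rrel n I J ≠ 0 →
    ∀ a b : Fin 4, (∀ t : Fin 2, I t ≠ J a) → (∀ t : Fin 2, I t ≠ J b) →
      psiLT S (wvec n S I J a) (wvec n S I J b) →
      evalF c (wvec n S I J a) < evalF c (wvec n S I J b)

end

/-! ### Initial terms with respect to an additive map to an ordered monoid -/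

section Initial

variable {σ ι Γ : Type*} [AddCommMonoid Γ] [LinearOrder Γ]

/-- `v` is the strict `ρ`-minimum of the support of `f`, with coefficient `c`. -/
def IsInit (ρ : (σ →₀ ℕ) →+ Γ) (f : MvPolynomial σ ℂ) (v : σ →₀ ℕ) (c : ℂ) : Prop :=
  c ≠ 0 ∧ coeff v f = c ∧ ∀ d ∈ f.support, d ≠ v → ρ v < ρ d

theorem IsInit.le {ρ : (σ →₀ ℕ) →+ Γ} {f : MvPolynomial σ ℂ} {v : σ →₀ ℕ} {c : ℂ}
    (h : IsInit ρ f v c) {d : σ →₀ ℕ} (hd : coeff d f ≠ 0) : ρ v ≤ ρ d := by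
  by_cases hv : d = v
  · rw [hv]
  · exact (h.2.2 d (mem_support_iff.2 hd) hv).le

theorem isInit_one (ρ : (σ →₀ ℕ) →+ Γ) : IsInit ρ (1 : MvPolynomial σ ℂ) 0 1 := by
  classical
  refine ⟨one_ne_zero, coeff_zero_one, fun d hd hne => ?_⟩
  rw [mem_support_iff, coeff_one, if_neg (Ne.symm hne)] at hd
  exact absurd rfl hd

variable [IsOrderedCancelAddMonoid Γ]

theorem IsInit.mul {ρ : (σ →₀ ℕ) →+ Γ} {f g : MvPolynomial σ ℂ} {v w : σ →₀ ℕ} {c e : ℂ}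
    (hf : IsInit ρ f v c) (hg : IsInit ρ g w e) : IsInit ρ (f * g) (v + w) (c * e) := by
  classical
  have key : ∀ a b : σ →₀ ℕ, coeff a f ≠ 0 → coeff b g ≠ 0 → (a, b) ≠ (v, w) →
      ρ (v + w) < ρ (a + b) := by
    intro a b ha hb hab
    rw [map_add, map_add]
    by_cases hav : a = v
    · have hbw : b ≠ w := fun h => hab (by rw [hav, h])
      exact add_lt_add_of_le_of_lt (hf.le ha) (hg.2.2 b (mem_support_iff.2 hb) hbw)
    · exact add_lt_add_of_lt_of_le (hf.2.2 a (mem_support_iff.2 ha) hav) (hg.le hb)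
  refine ⟨mul_ne_zero hf.1 hg.1, ?_, ?_⟩
  · rw [coeff_mul, Finset.sum_eq_single (v, w), hf.2.1, hg.2.1]
    · rintro ⟨a, b⟩ hab hne
      by_contra h
      have h1 := key a b (left_ne_zero_of_mul h) (right_ne_zero_of_mul h) hne
      rw [Finset.HasAntidiagonal.mem_antidiagonal.1 hab] at h1
      exact lt_irrefl _ h1
    · intro h
      exact absurd ((Finset.HasAntidiagonal.mem_antidiagonal (n := v + w) (a := (v, w))).2 rfl) h
  · intro d hd hne
    rw [mem_support_iff, coeff_mul] at hd
    obtain ⟨⟨a, b⟩, hab, h⟩ := Finset.exists_ne_zero_of_sum_ne_zero hd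
    have hd' : a + b = d := Finset.HasAntidiagonal.mem_antidiagonal.1 hab
    rw [← hd']
    refine key a b (left_ne_zero_of_mul h) (right_ne_zero_of_mul h) ?_
    rintro h
    simp only [Prod.mk.injEq] at h
    exact hne (by rw [← hd', h.1, h.2])

theorem IsInit.pow {ρ : (σ →₀ ℕ) →+ Γ} {f : MvPolynomial σ ℂ} {v : σ →₀ ℕ} {c : ℂ}
    (hf : IsInit ρ f v c) (n : ℕ) : IsInit ρ (f ^ n) (n • v) (c ^ n) := by
  induction n with
  | zero => simpa using isInit_one ρ
  | succ n ih => simpa only [pow_succ, succ_nsmul] using ih.mul hf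

/-- The exponent of the monomial obtained by substituting monomials of exponents `v`. -/
noncomputable def expSum (v : ι → σ →₀ ℕ) : (ι →₀ ℕ) →+ (σ →₀ ℕ) where
  toFun m := m.sum fun K c => c • v K
  map_zero' := Finsupp.sum_zero_index
  map_add' _ _ := Finsupp.sum_add_index' (fun _ => zero_nsmul _) fun _ _ _ => add_nsmul _ _ _

theorem expSum_single (v : ι → σ →₀ ℕ) (K : ι) (n : ℕ) :
    expSum v (Finsupp.single K n) = n • v K :=
  Finsupp.sum_single_index (h := fun K c => c • v K) (zero_nsmul _)

/-- Substituting polynomials with initial terms into a monomial gives the initial term of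
the result. -/
theorem exists_isInit_aeval_monomial {ρ : (σ →₀ ℕ) →+ Γ} {g : ι → MvPolynomial σ ℂ}
    {v : ι → σ →₀ ℕ} {c : ι → ℂ} (h : ∀ K, IsInit ρ (g K) (v K) (c K)) (m : ι →₀ ℕ) :
    ∃ e, IsInit ρ (aeval g (monomial m (1 : ℂ))) (expSum v m) e ∧
      aeval (fun K => monomial (v K) (c K)) (monomial m (1 : ℂ)) = monomial (expSum v m) e := by
  induction m using Finsupp.induction_linear with
  | zero => exact ⟨1, by simpa using isInit_one ρ, by simp⟩
  | add m m' ih ih' =>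
    obtain ⟨e, h1, h2⟩ := ih
    obtain ⟨e', h1', h2'⟩ := ih'
    have hm : monomial (m + m') (1 : ℂ) = monomial m 1 * monomial m' 1 := by
      rw [monomial_mul, one_mul]
    refine ⟨e * e', ?_, ?_⟩
    · rw [hm, map_mul, map_add]
      exact h1.mul h1'
    · rw [hm, map_mul, map_add, h2, h2', monomial_mul]
  | single K n =>
    refine ⟨c K ^ n, ?_, ?_⟩
    · rw [aeval_monomial, Finsupp.prod_single_index (by rw [pow_zero]), expSum_single, map_one, one_mul]
      exact (h K).pow n
    · rw [aeval_monomial, Finsupp.prod_single_index (by rw [pow_zero]), expSum_single, map_one, one_mul,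
        monomial_pow]

theorem coeff_aeval_eq_sum (g : ι → MvPolynomial σ ℂ) (f : MvPolynomial ι ℂ) (w : σ →₀ ℕ) :
    coeff w (aeval g f) =
      ∑ m ∈ f.support, coeff m f * coeff w (aeval g (monomial m (1 : ℂ))) := by
  conv_lhs => rw [f.as_sum, map_sum, coeff_sum]
  refine Finset.sum_congr rfl fun m _ => ?_
  rw [← mul_one (coeff m f), ← smul_eq_mul, ← smul_monomial, map_smul, coeff_smul, smul_eq_mul,
    smul_eq_mul, mul_one]

/-- The part of `f` of minimal weight lies in the toric ideal of the initial terms, whenever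
`f` is a relation between the `g K`. -/
theorem aeval_initial_eq_zero {ρ : (σ →₀ ℕ) →+ Γ} {g : ι → MvPolynomial σ ℂ}
    {v : ι → σ →₀ ℕ} {c : ι → ℂ} (h : ∀ K, IsInit ρ (g K) (v K) (c K))
    {f : MvPolynomial ι ℂ} (hf : aeval g f = 0) (s : Finset (ι →₀ ℕ))
    (hs : ∀ m, m ∈ s ↔ m ∈ f.support ∧ ∀ m' ∈ f.support, ρ (expSum v m) ≤ ρ (expSum v m')) :
    aeval (fun K => monomial (v K) (c K)) (∑ m ∈ s, monomial m (coeff m f)) = 0 := by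
  classical
  choose e he hτ using exists_isInit_aeval_monomial h
  have hterm : ∀ m, aeval (fun K => monomial (v K) (c K)) (monomial m (coeff m f)) =
      monomial (expSum v m) (coeff m f * e m) := by
    intro m
    rw [← mul_one (coeff m f), ← smul_eq_mul, ← smul_monomial, map_smul, hτ, smul_monomial,
      smul_eq_mul, smul_eq_mul, mul_one]
  ext w
  rw [map_sum, coeff_sum, coeff_zero]
  by_cases hw : ∃ m₀ ∈ s, expSum v m₀ = w
  · obtain ⟨m₀, hm₀, rfl⟩ := hw
    have h0 := coeff_aeval_eq_sum g f (expSum v m₀)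
    rw [hf, coeff_zero] at h0
    rw [h0]
    have hsub : s ⊆ f.support := fun m hm => ((hs m).1 hm).1
    rw [← Finset.sum_subset hsub]
    · refine Finset.sum_congr rfl fun m hm => ?_
      rw [hterm, coeff_monomial]
      split_ifs with heq
      · rw [← heq, (he m).2.1]
      · by_contra hne
        have h1 : coeff (expSum v m₀) (aeval g (monomial m (1 : ℂ))) ≠ 0 :=
          fun h => hne (by rw [h, mul_zero])
        have h2 := (he m).2.2 _ (mem_support_iff.2 h1) (Ne.symm heq)
        exact absurd (((hs m₀).1 hm₀).2 m (hsub hm)) (not_le.2 h2)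
    · intro m hm hms
      by_contra hne
      have h1 : coeff (expSum v m₀) (aeval g (monomial m (1 : ℂ))) ≠ 0 :=
        fun h => hne (by rw [h, mul_zero])
      exact hms ((hs m).2 ⟨hm, fun m' hm' =>
        ((he m).le h1).trans (((hs m₀).1 hm₀).2 m' hm')⟩)
  · refine Finset.sum_eq_zero fun m hm => ?_
    rw [hterm, coeff_monomial, if_neg fun h => hw ⟨m, hm, h⟩]

/-- An element of a toric ideal has no isolated monomial. -/
theorem exists_ne_expSum_eq {v : ι → σ →₀ ℕ} {c : ι → ℂ} (hc : ∀ K, c K ≠ 0)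
    {f : MvPolynomial ι ℂ} (hf : aeval (fun K => monomial (v K) (c K)) f = 0)
    {m : ι →₀ ℕ} (hm : m ∈ f.support) :
    ∃ m' ∈ f.support, m' ≠ m ∧ expSum v m' = expSum v m := by
  classical
  have hinit : ∀ K, IsInit (0 : (σ →₀ ℕ) →+ ℕ) (monomial (v K) (c K)) (v K) (c K) := by
    intro K
    refine ⟨hc K, by rw [coeff_monomial, if_pos rfl], fun d hd hne => ?_⟩
    rw [mem_support_iff, coeff_monomial, if_neg (Ne.symm hne)] at hd
    exact absurd rfl hd
  choose e he hτ using exists_isInit_aeval_monomial hinit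
  by_contra! hcon
  have h0 := coeff_aeval_eq_sum (fun K => monomial (v K) (c K)) f (expSum v m)
  rw [hf, coeff_zero, Finset.sum_eq_single m, hτ, coeff_monomial, if_pos rfl] at h0
  · exact mul_ne_zero (mem_support_iff.1 hm) (he m).1 h0.symm
  · intro m' hm' hne
    rw [hτ, coeff_monomial, if_neg (hcon m' hm' hne), mul_zero]
  · exact fun h => absurd hm h

end Initial

/-! ### The order `psiLE` as the order of a lexicographic product -/

theorem Psi_add (a b : (ℕ × ℕ) →₀ ℕ) : Psi (a + b) = Psi a + Psi b :=
  Finsupp.sum_add_index' (fun _ => zero_mul _) fun _ _ _ => add_mul _ _ _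

/-- The height of an exponent, followed by its negated coordinates along `S`. -/
def rhoFun (S : List (ℕ × ℕ)) (d : (ℕ × ℕ) →₀ ℕ) : ℕ → ℤ
  | 0 => Psi d
  | k + 1 => if k < S.length then -(d (S.getD k (0, 0)) : ℤ) else 0

/-- The weight of an exponent whose lexicographic order is `psiLE S`. -/
noncomputable def rho (S : List (ℕ × ℕ)) : ((ℕ × ℕ) →₀ ℕ) →+ Lex (ℕ → ℤ) where
  toFun d := toLex (rhoFun S d)
  map_zero' := by
    apply ofLex.injective
    funext k
    change rhoFun S 0 k = 0
    cases k <;> simp [rhoFun, Psi]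
  map_add' a b := by
    apply ofLex.injective
    funext k
    change rhoFun S (a + b) k = rhoFun S a k + rhoFun S b k
    cases k with
    | zero => simp [rhoFun, Psi_add]
    | succ k =>
      by_cases h : k < S.length
      · simp [rhoFun, h]; ring
      · simp [rhoFun, h]

theorem rho_zero (S : List (ℕ × ℕ)) (d : (ℕ × ℕ) →₀ ℕ) : ofLex (rho S d) 0 = Psi d := rfl

theorem rho_succ (S : List (ℕ × ℕ)) (d : (ℕ × ℕ) →₀ ℕ) (k : ℕ) :
    ofLex (rho S d) (k + 1) = if k < S.length then -(d (S.getD k (0, 0)) : ℤ) else 0 := rfl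

theorem rho_lt_iff {S : List (ℕ × ℕ)} {a b : (ℕ × ℕ) →₀ ℕ} :
    rho S a < rho S b ↔ psiLT S a b := by
  have hlt : rho S a < rho S b ↔ ∃ i, (∀ j < i, ofLex (rho S a) j = ofLex (rho S b) j) ∧
      ofLex (rho S a) i < ofLex (rho S b) i := Iff.rfl
  rw [hlt]
  constructor
  · rintro ⟨_ | k, h1, h2⟩
    · rw [rho_zero, rho_zero] at h2
      exact Or.inl (by exact_mod_cast h2)
    · have h0 := h1 0 (Nat.succ_pos k)
      rw [rho_zero, rho_zero] at h0
      rw [rho_succ, rho_succ] at h2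
      by_cases hk : k < S.length
      · rw [if_pos hk, if_pos hk] at h2
        refine Or.inr ⟨by exact_mod_cast h0, k, hk, fun m hm => ?_, by omega⟩
        have h3 := h1 (m + 1) (by omega)
        rw [rho_succ, rho_succ, if_pos (hm.trans hk), if_pos (hm.trans hk)] at h3
        omega
      · rw [if_neg hk, if_neg hk] at h2
        exact absurd h2 (lt_irrefl _)
  · rintro (h | ⟨h, k, hk, h1, h2⟩)
    · exact ⟨0, fun j hj => absurd hj (Nat.not_lt_zero j), by
        rw [rho_zero, rho_zero]; exact_mod_cast h⟩
    · refine ⟨k + 1, fun j hj => ?_, ?_⟩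
      · cases j with
        | zero => rw [rho_zero, rho_zero, h]
        | succ m =>
          have hm : m < k := by omega
          rw [rho_succ, rho_succ, if_pos (hm.trans hk), if_pos (hm.trans hk), h1 m hm]
      · rw [rho_succ, rho_succ, if_pos hk, if_pos hk]
        omega

theorem rho_eq_iff {S : List (ℕ × ℕ)} {a b : (ℕ × ℕ) →₀ ℕ} :
    rho S a = rho S b ↔ Psi a = Psi b ∧ ∀ k < S.length,
      a (S.getD k (0, 0)) = b (S.getD k (0, 0)) := by
  constructor
  · intro h
    have hk := fun k => congrFun (congrArg ofLex h) k
    refine ⟨?_, fun k hkl => ?_⟩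
    · have h0 := hk 0
      rw [rho_zero, rho_zero] at h0
      exact_mod_cast h0
    have h1 := hk (k + 1)
    rw [rho_succ, rho_succ, if_pos hkl, if_pos hkl] at h1
    omega
  · rintro ⟨h0, h1⟩
    apply ofLex.injective
    funext k
    cases k with
    | zero => rw [rho_zero, rho_zero, h0]
    | succ k =>
      rw [rho_succ, rho_succ]
      split_ifs with hk
      · rw [h1 k hk]
      · rfl

theorem rho_le_iff {S : List (ℕ × ℕ)} {a b : (ℕ × ℕ) →₀ ℕ} :
    rho S a ≤ rho S b ↔ psiLE S a b := by
  refine (le_iff_lt_or_eq.trans (or_congr rho_lt_iff rho_eq_iff)).trans ?_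
  unfold psiLE psiLT lexLE
  have hsymm : (∀ k < S.length, a (S.getD k (0, 0)) = b (S.getD k (0, 0))) ↔
      ∀ k < S.length, b (S.getD k (0, 0)) = a (S.getD k (0, 0)) :=
    forall₂_congr fun _ _ => eq_comm
  rw [hsymm]
  tauto

theorem eq_of_rho_eq {S : List (ℕ × ℕ)} {a b : (ℕ × ℕ) →₀ ℕ} (ha : ∀ β ∉ S, a β = 0)
    (hb : ∀ β ∉ S, b β = 0) (h : rho S a = rho S b) : a = b := by
  ext β
  by_cases hβ : β ∈ S
  · obtain ⟨k, hk, rfl⟩ := List.getElem_of_mem hβ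
    have h1 := (rho_eq_iff.1 h).2 k hk
    rwa [List.getD_eq_getElem _ _ hk] at h1
  · rw [ha β hβ, hb β hβ]

theorem lexLT_cons {β : ℕ × ℕ} {S : List (ℕ × ℕ)} {a b : (ℕ × ℕ) →₀ ℕ} :
    lexLT (β :: S) a b ↔ a β < b β ∨ (a β = b β ∧ lexLT S a b) := by
  constructor
  · rintro ⟨_ | k, hk, h1, h2⟩
    · exact Or.inl (by simpa using h2)
    · exact Or.inr ⟨by simpa using h1 0 (Nat.succ_pos k), k, by simpa using hk,
        fun m hm => by simpa using h1 (m + 1) (by omega), by simpa using h2⟩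
  · rintro (h | ⟨h0, k, hk, h1, h2⟩)
    · exact ⟨0, by simp, fun m hm => absurd hm (Nat.not_lt_zero m), by simpa using h⟩
    · refine ⟨k + 1, by simpa using hk, fun m hm => ?_, by simpa using h2⟩
      cases m with
      | zero => simpa using h0
      | succ m => simpa using h1 m (by omega)

theorem not_lexLT_nil {a b : (ℕ × ℕ) →₀ ℕ} : ¬ lexLT [] a b := by
  rintro ⟨k, hk, -⟩
  exact absurd hk (Nat.not_lt_zero k)

theorem lexLT_add_left {S : List (ℕ × ℕ)} (c a b : (ℕ × ℕ) →₀ ℕ) :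
    lexLT S (c + a) (c + b) ↔ lexLT S a b := by
  simp [lexLT]

theorem minSupp_eq {S : List (ℕ × ℕ)} {f : MvPolynomial (ℕ × ℕ) ℂ} {v : (ℕ × ℕ) →₀ ℕ} {c : ℂ}
    (h : IsInit (rho S) f v c) : minSupp S f = v := by
  have hv : v ∈ f.support := mem_support_iff.2 (h.2.1.symm ▸ h.1)
  have hex : ∃ m ∈ f.support, ∀ m' ∈ f.support, psiLE S m m' :=
    ⟨v, hv, fun m' hm' => rho_le_iff.1 (h.le (mem_support_iff.1 hm'))⟩
  rw [minSupp, dif_pos hex]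
  by_contra hne
  have h1 := h.2.2 _ hex.choose_spec.1 hne
  exact absurd (rho_le_iff.2 (hex.choose_spec.2 v hv)) (not_le.2 h1)

/-! ### The minors of `A_S` -/

/-- The minor of `A_S` on rows `1, 2, 3` and columns `a, b, c`, in this order. -/
noncomputable def colDet (S : List (ℕ × ℕ)) (a b c : ℕ) : MvPolynomial (ℕ × ℕ) ℂ :=
  Matrix.det (Matrix.of fun x y : Fin 3 => ASmat 6 S (x.val + 1) (![a, b, c] y))

theorem colDet_eq (S : List (ℕ × ℕ)) (a b c : ℕ) : colDet S a b c =
    ASmat 6 S 1 a * ASmat 6 S 2 b * ASmat 6 S 3 c - ASmat 6 S 1 a * ASmat 6 S 2 c * ASmat 6 S 3 b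
    - ASmat 6 S 1 b * ASmat 6 S 2 a * ASmat 6 S 3 c + ASmat 6 S 1 b * ASmat 6 S 2 c * ASmat 6 S 3 a
    + ASmat 6 S 1 c * ASmat 6 S 2 a * ASmat 6 S 3 b
    - ASmat 6 S 1 c * ASmat 6 S 2 b * ASmat 6 S 3 a := by
  simp [colDet, Matrix.det_fin_three]

theorem phiStar_eq (S : List (ℕ × ℕ)) (I : Fin 3 → ℕ) :
    phiStar 6 S I = colDet S (I 0) (I 1) (I 2) := by
  simp [colDet, phiStar, Matrix.det_fin_three]

theorem colDet_swap (S : List (ℕ × ℕ)) (a b c : ℕ) : colDet S b a c = -colDet S a b c := by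
  rw [colDet_eq, colDet_eq]; ring

theorem colDet_swap' (S : List (ℕ × ℕ)) (a b c : ℕ) : colDet S a c b = -colDet S a b c := by
  rw [colDet_eq, colDet_eq]; ring

theorem colDet_self (S : List (ℕ × ℕ)) (a b : ℕ) : colDet S a b b = 0 := by
  rw [colDet_eq]; ring

theorem colDet_eq_zero {S : List (ℕ × ℕ)} {a b c : ℕ} (h : c = a ∨ c = b) :
    colDet S a b c = 0 := by
  rw [colDet_eq]
  rcases h with rfl | rfl <;> ring

theorem ASmat_cons {β : ℕ × ℕ} (S : List (ℕ × ℕ)) (x : ℕ) {j : ℕ} (hj : j ∈ Finset.Icc 1 6)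
    (hβ : β.1 ∈ Finset.Icc 1 6) : ASmat 6 (β :: S) x j =
      ASmat 6 S x j + if j = β.2 then ASmat 6 S x β.1 * X β else 0 := by
  simp only [ASmat, matMul, factor, mul_add, Finset.sum_add_distrib, mul_ite, mul_one, mul_zero,
    Finset.sum_ite_eq', if_pos hj]
  congr 1
  split_ifs with h
  · simp only [h, and_true, Finset.sum_ite_eq', if_pos hβ]
  · simp [h]

/-- The sequence with the iteration triple of column `r` prepended. -/
def consTriple (r i₁ i₂ i₃ : ℕ) (L : List (ℕ × ℕ)) : List (ℕ × ℕ) :=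
  (i₁, r) :: (i₂, r) :: (i₃, r) :: L

/-- The indices of an iteration triple with values in `{1, …, r}`. -/
structure IsTriple (r i₁ i₂ i₃ : ℕ) : Prop where
  mem₁ : i₁ ∈ Finset.Icc 1 r
  mem₂ : i₂ ∈ Finset.Icc 1 r
  mem₃ : i₃ ∈ Finset.Icc 1 r
  ne₁₂ : i₁ ≠ i₂
  ne₁₃ : i₁ ≠ i₃
  ne₂₃ : i₂ ≠ i₃

theorem ASmat_consTriple {r i₁ i₂ i₃ : ℕ} (hr : r + 1 ≤ 6) (hi : IsTriple r i₁ i₂ i₃)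
    (L : List (ℕ × ℕ)) (x : ℕ) {j : ℕ} (hj : j ∈ Finset.Icc 1 6) :
    ASmat 6 (consTriple (r + 1) i₁ i₂ i₃ L) x j = ASmat 6 L x j + if j = r + 1 then
      ASmat 6 L x i₁ * X (i₁, r + 1) + ASmat 6 L x i₂ * X (i₂, r + 1) +
        ASmat 6 L x i₃ * X (i₃, r + 1) else 0 := by
  have h1 := Finset.mem_Icc.1 hi.mem₁
  have h2 := Finset.mem_Icc.1 hi.mem₂
  have h3 := Finset.mem_Icc.1 hi.mem₃
  have h1' : i₁ ∈ Finset.Icc 1 6 := Finset.mem_Icc.2 (by omega)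
  have h2' : i₂ ∈ Finset.Icc 1 6 := Finset.mem_Icc.2 (by omega)
  have h3' : i₃ ∈ Finset.Icc 1 6 := Finset.mem_Icc.2 (by omega)
  have e1 : i₁ ≠ r + 1 := by omega
  have e2 : i₂ ≠ r + 1 := by omega
  unfold consTriple
  simp only [ASmat_cons (β := (i₁, r + 1)) _ _ hj h1', ASmat_cons (β := (i₂, r + 1)) _ _ hj h2',
    ASmat_cons (β := (i₃, r + 1)) _ _ hj h3', ASmat_cons (β := (i₂, r + 1)) _ _ h1' h2',
    ASmat_cons (β := (i₃, r + 1)) _ _ h1' h3', ASmat_cons (β := (i₃, r + 1)) _ _ h2' h3',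
    e1, e2, if_false, add_zero]
  split_ifs <;> ring

/-- The torus weight of an exponent, where `x_{(i,j)}` has weight `e_j - e_i`. -/
noncomputable def wt (t : ℕ) : ((ℕ × ℕ) →₀ ℕ) →+ ℤ where
  toFun d := d.sum fun β c => (c : ℤ) * ((if β.2 = t then 1 else 0) - if β.1 = t then 1 else 0)
  map_zero' := Finsupp.sum_zero_index
  map_add' _ _ := Finsupp.sum_add_index' (fun _ => by simp) fun _ _ _ => by push_cast; ring

theorem wt_single (t : ℕ) (β : ℕ × ℕ) (n : ℕ) : wt t (Finsupp.single β n) =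
    (n : ℤ) * ((if β.2 = t then 1 else 0) - if β.1 = t then 1 else 0) := by
  simp [wt]

/-- The torus weight of the minor with columns `a, b, c`. -/
def minorWt (a b c t : ℕ) : ℤ :=
  (if a = t then 1 else 0) + (if b = t then 1 else 0) + (if c = t then 1 else 0) -
    (if 1 = t then 1 else 0) - (if 2 = t then 1 else 0) - if 3 = t then 1 else 0

/-- The effect of an iteration step on the exponents of the initial terms of minors. -/
noncomputable def vstep (r i₁ i₂ i₃ : ℕ) (v : Finset ℕ → (ℕ × ℕ) →₀ ℕ) (K : Finset ℕ) :
    (ℕ × ℕ) →₀ ℕ :=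
  if r ∈ K then
    if i₁ ∉ K then Finsupp.single (i₁, r) 1 + v (insert i₁ (K.erase r))
    else if i₂ ∉ K then Finsupp.single (i₂, r) 1 + v (insert i₂ (K.erase r))
    else Finsupp.single (i₃, r) 1 + v (insert i₃ (K.erase r))
  else v K

/-- The support of a minor and its lexicographic maximum `v {a, b, c}`. -/
def MinorSpec (L : List (ℕ × ℕ)) (v : Finset ℕ → (ℕ × ℕ) →₀ ℕ) (a b c : ℕ) : Prop :=
  (∀ d ∈ (colDet L a b c).support, (∀ β ∉ L, d β = 0) ∧ ∀ t, wt t d = minorWt a b c t) ∧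
  (a ≠ b → a ≠ c → b ≠ c → v {a, b, c} ∈ (colDet L a b c).support ∧
    ∀ d ∈ (colDet L a b c).support, d ≠ v {a, b, c} → lexLT L d (v {a, b, c}))

theorem MinorSpec.swap {L : List (ℕ × ℕ)} {v : Finset ℕ → (ℕ × ℕ) →₀ ℕ} {a b c : ℕ}
    (h : MinorSpec L v a b c) : MinorSpec L v b a c := by
  have hs : ({b, a, c} : Finset ℕ) = {a, b, c} := by ext; simp; tauto
  have hw : ∀ t, minorWt b a c t = minorWt a b c t := fun t => by unfold minorWt; ring
  unfold MinorSpec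
  rw [colDet_swap, support_neg, hs]
  simp only [hw]
  exact ⟨h.1, fun h1 h2 h3 => h.2 h1.symm h3 h2⟩

theorem MinorSpec.swap' {L : List (ℕ × ℕ)} {v : Finset ℕ → (ℕ × ℕ) →₀ ℕ} {a b c : ℕ}
    (h : MinorSpec L v a b c) : MinorSpec L v a c b := by
  have hs : ({a, c, b} : Finset ℕ) = {a, b, c} := by ext; simp; tauto
  have hw : ∀ t, minorWt a c b t = minorWt a b c t := fun t => by unfold minorWt; ring
  unfold MinorSpec
  rw [colDet_swap', support_neg, hs]
  simp only [hw]
  exact ⟨h.1, fun h1 h2 h3 => h.2 h2 h1 h3.symm⟩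

/-- The state of the iteration after column `r`. -/
structure IterSpec (r : ℕ) (L : List (ℕ × ℕ)) (v : Finset ℕ → (ℕ × ℕ) →₀ ℕ) : Prop where
  col : ∀ x j, x ≤ 3 → r < j → j ≤ 6 → ASmat 6 L x j = 0
  mem : ∀ β ∈ L, β.2 ≤ r
  minor : ∀ a ∈ Finset.Icc 1 r, ∀ b ∈ Finset.Icc 1 r, ∀ c ∈ Finset.Icc 1 r, MinorSpec L v a b c

theorem colDet_nil (a b c : ℕ) : colDet [] a b c =
    C (Matrix.det (Matrix.of fun x y : Fin 3 =>
      if (x.val + 1) = ![a, b, c] y then (1 : ℂ) else 0)) := by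
  simp [colDet, Matrix.det_fin_three, ASmat, idN, apply_ite C]

theorem iterSpec_nil : IterSpec 3 [] fun _ => 0 where
  col x j hx hj _ := by simp [ASmat, idN, show x ≠ j by omega]
  mem := by simp
  minor := by
    intro a ha b hb c hc
    have hne : a ≠ b → a ≠ c → b ≠ c → Matrix.det (Matrix.of fun x y : Fin 3 =>
        if (x.val + 1) = ![a, b, c] y then (1 : ℂ) else 0) ≠ 0 := by
      rw [Finset.mem_Icc] at ha hb hc
      obtain ⟨ha, ha'⟩ := ha
      obtain ⟨hb, hb'⟩ := hb
      obtain ⟨hc, hc'⟩ := hc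
      interval_cases a <;> interval_cases b <;> interval_cases c <;>
        simp [Matrix.det_fin_three]
    have hd : ∀ d ∈ (colDet [] a b c).support, d = 0 := by
      classical
      intro d hd
      rw [mem_support_iff, colDet_nil, coeff_C] at hd
      by_contra h
      rw [if_neg (Ne.symm h)] at hd
      exact hd rfl
    refine ⟨fun d hds => ?_, fun h1 h2 h3 => ⟨?_, fun d hds h => absurd (hd d hds) h⟩⟩
    · rw [hd d hds]
      refine ⟨fun _ _ => rfl, fun t => ?_⟩
      by_cases h : a ≠ b ∧ a ≠ c ∧ b ≠ c
      · rw [map_zero]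
        rw [Finset.mem_Icc] at ha hb hc
        unfold minorWt
        obtain ⟨h1, h2, h3⟩ := h
        split_ifs <;> omega
      · have h0 : colDet [] a b c = 0 := by
          by_cases hab : a = b
          · rw [hab, ← neg_eq_zero, ← colDet_swap', ← neg_eq_zero, ← colDet_swap, colDet_self]
          · exact colDet_eq_zero (by grind)
        rw [h0] at hds
        simp at hds
    · rw [colDet_nil, mem_support_iff, coeff_C, if_pos rfl]
      exact hne h1 h2 h3

section Step

variable {r i₁ i₂ i₃ : ℕ} {L : List (ℕ × ℕ)} {v : Finset ℕ → (ℕ × ℕ) →₀ ℕ}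

theorem colDet_consTriple_of_le (hr : r + 1 ≤ 6) (hi : IsTriple r i₁ i₂ i₃) {a b c : ℕ}
    (ha : a ∈ Finset.Icc 1 r) (hb : b ∈ Finset.Icc 1 r) (hc : c ∈ Finset.Icc 1 r) :
    colDet (consTriple (r + 1) i₁ i₂ i₃ L) a b c = colDet L a b c := by
  have key : ∀ x, ∀ j ∈ Finset.Icc 1 r,
      ASmat 6 (consTriple (r + 1) i₁ i₂ i₃ L) x j = ASmat 6 L x j := by
    intro x j hj
    rw [Finset.mem_Icc] at hj
    rw [ASmat_consTriple hr hi L x (Finset.mem_Icc.2 (by omega)), if_neg (by omega), add_zero]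
  simp only [colDet_eq, key _ _ ha, key _ _ hb, key _ _ hc]

theorem colDet_consTriple (hr : r + 1 ≤ 6) (hi : IsTriple r i₁ i₂ i₃) (h : IterSpec r L v)
    {a b : ℕ} (ha : a ∈ Finset.Icc 1 r) (hb : b ∈ Finset.Icc 1 r) :
    colDet (consTriple (r + 1) i₁ i₂ i₃ L) a b (r + 1) = X (i₁, r + 1) * colDet L a b i₁ +
      X (i₂, r + 1) * colDet L a b i₂ + X (i₃, r + 1) * colDet L a b i₃ := by
  have key : ∀ x, ∀ j ∈ Finset.Icc 1 r,
      ASmat 6 (consTriple (r + 1) i₁ i₂ i₃ L) x j = ASmat 6 L x j := by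
    intro x j hj
    rw [Finset.mem_Icc] at hj
    rw [ASmat_consTriple hr hi L x (Finset.mem_Icc.2 (by omega)), if_neg (by omega), add_zero]
  have last : ∀ x, x ≤ 3 → ASmat 6 (consTriple (r + 1) i₁ i₂ i₃ L) x (r + 1) =
      ASmat 6 L x i₁ * X (i₁, r + 1) + ASmat 6 L x i₂ * X (i₂, r + 1) +
        ASmat 6 L x i₃ * X (i₃, r + 1) := by
    intro x hx
    rw [ASmat_consTriple hr hi L x (Finset.mem_Icc.2 (by omega)), if_pos rfl,
      h.col x (r + 1) hx (Nat.lt_succ_self r) hr, zero_add]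
  simp only [colDet_eq, key _ _ ha, key _ _ hb, last 1 (by omega), last 2 (by omega),
    last 3 (by omega)]
  ring

theorem exists_of_mem_support_X_mul {β : ℕ × ℕ} {p : MvPolynomial (ℕ × ℕ) ℂ}
    {d : (ℕ × ℕ) →₀ ℕ} (hd : coeff d (X β * p) ≠ 0) :
    ∃ d' ∈ p.support, d = Finsupp.single β 1 + d' := by
  classical
  have h := mem_support_iff.2 hd
  rw [support_X_mul, Finset.mem_map] at h
  obtain ⟨d', hd', rfl⟩ := h
  exact ⟨d', hd', rfl⟩

theorem exists_of_mem_support_consTriple (hr : r + 1 ≤ 6) (hi : IsTriple r i₁ i₂ i₃)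
    (h : IterSpec r L v) {a b : ℕ} (ha : a ∈ Finset.Icc 1 r) (hb : b ∈ Finset.Icc 1 r)
    {d : (ℕ × ℕ) →₀ ℕ}
    (hd : d ∈ (colDet (consTriple (r + 1) i₁ i₂ i₃ L) a b (r + 1)).support) :
    ∃ k, (k = i₁ ∨ k = i₂ ∨ k = i₃) ∧ ∃ d' ∈ (colDet L a b k).support,
      d = Finsupp.single (k, r + 1) 1 + d' := by
  rw [colDet_consTriple hr hi h ha hb, mem_support_iff, coeff_add, coeff_add] at hd
  by_cases h1 : coeff d (X (i₁, r + 1) * colDet L a b i₁) = 0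
  · by_cases h2 : coeff d (X (i₂, r + 1) * colDet L a b i₂) = 0
    · rw [h1, h2, zero_add, zero_add] at hd
      exact ⟨i₃, Or.inr (Or.inr rfl), exists_of_mem_support_X_mul hd⟩
    · exact ⟨i₂, Or.inr (Or.inl rfl), exists_of_mem_support_X_mul h2⟩
  · exact ⟨i₁, Or.inl rfl, exists_of_mem_support_X_mul h1⟩

theorem single_add_mem_support (hr : r + 1 ≤ 6) (hi : IsTriple r i₁ i₂ i₃)
    (h : IterSpec r L v) {a b k : ℕ} (ha : a ∈ Finset.Icc 1 r) (hb : b ∈ Finset.Icc 1 r)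
    (hk : k = i₁ ∨ k = i₂ ∨ k = i₃) {d : (ℕ × ℕ) →₀ ℕ} (hd0 : ∀ i, d (i, r + 1) = 0)
    (hd : d ∈ (colDet L a b k).support) : Finsupp.single (k, r + 1) 1 + d ∈
      (colDet (consTriple (r + 1) i₁ i₂ i₃ L) a b (r + 1)).support := by
  classical
  have hself : coeff (Finsupp.single (k, r + 1) 1 + d) (X (k, r + 1) * colDet L a b k) ≠ 0 := by
    rw [coeff_X_mul]
    exact mem_support_iff.1 hd
  have hother : ∀ k', k ≠ k' →
      coeff (Finsupp.single (k, r + 1) 1 + d) (X (k', r + 1) * colDet L a b k') = 0 := by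
    intro k' hne
    rw [coeff_X_mul', if_neg]
    simp [hd0, hne]
  rw [mem_support_iff, colDet_consTriple hr hi h ha hb, coeff_add, coeff_add]
  have n12 := hi.ne₁₂
  have n13 := hi.ne₁₃
  have n23 := hi.ne₂₃
  rcases hk with rfl | rfl | rfl
  · rwa [hother i₂ n12, hother i₃ n13, add_zero, add_zero]
  · rwa [hother i₁ n12.symm, hother i₃ n23, add_zero, zero_add]
  · rwa [hother i₁ n13.symm, hother i₂ n23.symm, zero_add, zero_add]

theorem lexLT_consTriple {d e : (ℕ × ℕ) →₀ ℕ} (hd : ∀ i, d (i, r + 1) = 0)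
    (he : ∀ i, e (i, r + 1) = 0) (h : lexLT L d e) :
    lexLT (consTriple (r + 1) i₁ i₂ i₃ L) d e := by
  simp [consTriple, lexLT_cons, hd, he, h]

theorem vstep_insert (hi : IsTriple r i₁ i₂ i₃) {a b : ℕ} (ha : a ∈ Finset.Icc 1 r)
    (hb : b ∈ Finset.Icc 1 r) :
    ∃ k, ((k = i₁) ∨ (k = i₂ ∧ (i₁ = a ∨ i₁ = b)) ∨
        (k = i₃ ∧ (i₁ = a ∨ i₁ = b) ∧ (i₂ = a ∨ i₂ = b))) ∧ k ≠ a ∧ k ≠ b ∧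
      vstep (r + 1) i₁ i₂ i₃ v {a, b, r + 1} = Finsupp.single (k, r + 1) 1 + v {a, b, k} := by
  have h1 := Finset.mem_Icc.1 hi.mem₁
  have h2 := Finset.mem_Icc.1 hi.mem₂
  rw [Finset.mem_Icc] at ha hb
  have hs : ∀ k, insert k (({a, b, r + 1} : Finset ℕ).erase (r + 1)) = {a, b, k} := by
    intro k
    ext y
    simp only [Finset.mem_insert, Finset.mem_erase, Finset.mem_singleton]
    omega
  unfold vstep
  simp only [hs, Finset.mem_insert, Finset.mem_singleton, or_true, if_true, not_or,
    show i₁ ≠ r + 1 by omega, show i₂ ≠ r + 1 by omega, or_false]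
  have n12 := hi.ne₁₂
  have n13 := hi.ne₁₃
  have n23 := hi.ne₂₃
  by_cases c1 : i₁ = a ∨ i₁ = b
  · by_cases c2 : i₂ = a ∨ i₂ = b
    · exact ⟨i₃, by tauto, by omega, by omega, by rw [if_neg (by tauto), if_neg (by tauto)]⟩
    · exact ⟨i₂, by tauto, by tauto, by tauto, by rw [if_neg (by tauto), if_pos (by tauto)]⟩
  · exact ⟨i₁, by tauto, by tauto, by tauto, by rw [if_pos (by tauto)]⟩

theorem IterSpec.minor_last (hr : r + 1 ≤ 6) (hi : IsTriple r i₁ i₂ i₃)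
    (h : IterSpec r L v) {a b : ℕ} (ha : a ∈ Finset.Icc 1 r) (hb : b ∈ Finset.Icc 1 r) :
    MinorSpec (consTriple (r + 1) i₁ i₂ i₃ L) (vstep (r + 1) i₁ i₂ i₃ v) a b (r + 1) := by
  have hmem : ∀ k, (k = i₁ ∨ k = i₂ ∨ k = i₃) → k ∈ Finset.Icc 1 r := by
    rintro k (rfl | rfl | rfl)
    exacts [hi.mem₁, hi.mem₂, hi.mem₃]
  have hzero : ∀ k ∈ Finset.Icc 1 r, ∀ d ∈ (colDet L a b k).support, ∀ i, d (i, r + 1) = 0 := by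
    intro k hk d hd i
    refine ((h.minor a ha b hb k hk).1 d hd).1 _ fun hL => ?_
    have := h.mem _ hL
    simp at this
  constructor
  · intro d hd
    obtain ⟨k, hk, d', hd', rfl⟩ := exists_of_mem_support_consTriple hr hi h ha hb hd
    obtain ⟨h1, h2⟩ := (h.minor a ha b hb k (hmem k hk)).1 d' hd'
    refine ⟨fun β hβ => ?_, fun t => ?_⟩
    · simp only [consTriple, List.mem_cons, not_or] at hβ
      have hne : (k, r + 1) ≠ β := by
        rintro rfl
        rcases hk with rfl | rfl | rfl <;> tauto
      rw [Finsupp.add_apply, Finsupp.single_eq_of_ne hne.symm, h1 β hβ.2.2.2]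
    · rw [map_add, wt_single, Nat.cast_one, one_mul, h2]
      unfold minorWt
      ring
  · intro hab _ _
    obtain ⟨k, hk, hka, hkb, hv⟩ := vstep_insert (v := v) hi ha hb
    have hk' : k = i₁ ∨ k = i₂ ∨ k = i₃ := by tauto
    obtain ⟨hm, hmax⟩ := (h.minor a ha b hb k (hmem k hk')).2 hab hka.symm hkb.symm
    have hv0 := hzero k (hmem k hk') _ hm
    rw [hv]
    refine ⟨single_add_mem_support hr hi h ha hb hk' hv0 hm, fun d hd hne => ?_⟩
    obtain ⟨l, hl, d', hd', rfl⟩ := exists_of_mem_support_consTriple hr hi h ha hb hd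
    have hd0 := hzero l (hmem l hl) _ hd'
    have hlab : ¬ (l = a ∨ l = b) := by
      intro hl
      rw [colDet_eq_zero hl] at hd'
      simp at hd'
    by_cases hlk : l = k
    · subst hlk
      rw [lexLT_add_left]
      exact lexLT_consTriple hd0 hv0 (hmax d' hd' fun h => hne (by rw [h]))
    · have n12 := hi.ne₁₂
      have n13 := hi.ne₁₃
      have n23 := hi.ne₂₃
      simp only [consTriple, lexLT_cons, Finsupp.add_apply, hd0, hv0, add_zero,
        Finsupp.single_apply, Prod.mk.injEq, and_true]
      grind

theorem IterSpec.step (hr3 : 3 ≤ r) (hr : r + 1 ≤ 6) (hi : IsTriple r i₁ i₂ i₃)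
    (h : IterSpec r L v) :
    IterSpec (r + 1) (consTriple (r + 1) i₁ i₂ i₃ L) (vstep (r + 1) i₁ i₂ i₃ v) where
  col x j hx hj hj6 := by
    rw [ASmat_consTriple hr hi L x (Finset.mem_Icc.2 (by omega)), if_neg (by omega), add_zero,
      h.col x j hx (by omega) hj6]
  mem β hβ := by
    simp only [consTriple, List.mem_cons] at hβ
    rcases hβ with rfl | rfl | rfl | hβ
    · exact le_rfl
    · exact le_rfl
    · exact le_rfl
    · exact (h.mem β hβ).trans (Nat.le_succ r)
  minor := by
    have hlast : ∀ a ∈ Finset.Icc 1 (r + 1),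
        MinorSpec (consTriple (r + 1) i₁ i₂ i₃ L) (vstep (r + 1) i₁ i₂ i₃ v) a (r + 1) (r + 1) := by
      intro a _
      refine ⟨fun d hd => ?_, fun _ _ h3 => absurd rfl h3⟩
      rw [colDet_self] at hd
      simp at hd
    have hall : ∀ a ∈ Finset.Icc 1 r, ∀ b ∈ Finset.Icc 1 r, ∀ c ∈ Finset.Icc 1 r,
        MinorSpec (consTriple (r + 1) i₁ i₂ i₃ L) (vstep (r + 1) i₁ i₂ i₃ v) a b c := by
      intro a ha b hb c hc
      have hK : vstep (r + 1) i₁ i₂ i₃ v {a, b, c} = v {a, b, c} := by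
        rw [Finset.mem_Icc] at ha hb hc
        refine if_neg ?_
        simp only [Finset.mem_insert, Finset.mem_singleton]
        omega
      have hm := h.minor a ha b hb c hc
      have hzero : ∀ d ∈ (colDet L a b c).support, ∀ i, d (i, r + 1) = 0 := by
        intro d hd i
        refine (hm.1 d hd).1 _ fun hL => ?_
        have := h.mem _ hL
        simp at this
      unfold MinorSpec
      rw [colDet_consTriple_of_le hr hi ha hb hc, hK]
      refine ⟨fun d hd => ⟨fun β hβ => (hm.1 d hd).1 β ?_, (hm.1 d hd).2⟩, fun h1 h2 h3 => ?_⟩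
      · simp only [consTriple, List.mem_cons, not_or] at hβ
        exact hβ.2.2.2
      · obtain ⟨h4, h5⟩ := hm.2 h1 h2 h3
        exact ⟨h4, fun d hd hne =>
          lexLT_consTriple (hzero d hd) (hzero _ h4) (h5 d hd hne)⟩
    have hcase : ∀ j ∈ Finset.Icc 1 (r + 1), j = r + 1 ∨ j ∈ Finset.Icc 1 r := by
      intro j hj
      rw [Finset.mem_Icc] at hj ⊢
      omega
    intro a ha b hb c hc
    rcases hcase a ha with rfl | ha' <;> rcases hcase b hb with rfl | hb' <;>
      rcases hcase c hc with rfl | hc'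
    · exact hlast _ ha
    · exact (hlast c hc).swap.swap'
    · exact (hlast b hb).swap
    · exact (h.minor_last hr hi hb' hc').swap'.swap
    · exact hlast _ ha
    · exact (h.minor_last hr hi ha' hc').swap'
    · exact h.minor_last hr hi ha' hb'
    · exact hall a ha' b hb' c hc'

end Step

/-! ### Valuations of Plücker coordinates -/

theorem Psi_eq_sum_wt {d : (ℕ × ℕ) →₀ ℕ} (hd : ∀ β, d β ≠ 0 → β.1 ≤ β.2 ∧ β.2 ≤ 6) :
    (Psi d : ℤ) = ∑ t ∈ Finset.range 7, (t : ℤ) * wt t d := by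
  have hwt : ∀ t, wt t d = d.sum fun β c =>
      (c : ℤ) * ((if β.2 = t then 1 else 0) - if β.1 = t then 1 else 0) := fun _ => rfl
  simp only [hwt, Psi, Finsupp.sum, Finset.mul_sum]
  rw [Finset.sum_comm, Nat.cast_sum]
  refine Finset.sum_congr rfl fun β hβ => ?_
  obtain ⟨h1, h2⟩ := hd β (Finsupp.mem_support_iff.1 hβ)
  simp only [mul_sub, Finset.sum_sub_distrib, mul_ite, mul_one, mul_zero, Finset.sum_ite_eq,
    Finset.mem_range, show β.1 < 7 by omega, show β.2 < 7 by omega, if_true]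
  rw [Ht]
  push_cast [h1]
  ring

/-- The data of an iterated sequence for `Gr(3,6)`. -/
structure IterData where
  (i₁ i₂ i₃ j₁ j₂ j₃ b₁ b₂ b₃ : ℕ)
  triple₆ : IsTriple 5 i₁ i₂ i₃
  triple₅ : IsTriple 4 j₁ j₂ j₃
  triple₄ : IsTriple 3 b₁ b₂ b₃

namespace IterData

variable (D : IterData)

/-- The iterated sequence. -/
def seq : List (ℕ × ℕ) :=
  consTriple 6 D.i₁ D.i₂ D.i₃ (consTriple 5 D.j₁ D.j₂ D.j₃ (consTriple 4 D.b₁ D.b₂ D.b₃ []))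

/-- The valuations of the Plücker coordinates with columns in `{1, …, 4}`. -/
noncomputable def val₄ : Finset ℕ → (ℕ × ℕ) →₀ ℕ := vstep 4 D.b₁ D.b₂ D.b₃ fun _ => 0

/-- The valuations of the Plücker coordinates with columns in `{1, …, 5}`. -/
noncomputable def val₅ : Finset ℕ → (ℕ × ℕ) →₀ ℕ := vstep 5 D.j₁ D.j₂ D.j₃ D.val₄

/-- The valuations of the Plücker coordinates. -/
noncomputable def val : Finset ℕ → (ℕ × ℕ) →₀ ℕ := vstep 6 D.i₁ D.i₂ D.i₃ D.val₅

theorem iterSpec : IterSpec 6 D.seq D.val :=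
  ((iterSpec_nil.step le_rfl (by norm_num) D.triple₄).step (by norm_num) (by norm_num)
    D.triple₅).step (by norm_num) le_rfl D.triple₆

theorem root_of_mem_seq {β : ℕ × ℕ} (hβ : β ∈ D.seq) : β.1 ≤ β.2 ∧ β.2 ≤ 6 := by
  obtain ⟨h1, h2, h3, -⟩ := D.triple₆
  obtain ⟨h4, h5, h6, -⟩ := D.triple₅
  obtain ⟨h7, h8, h9, -⟩ := D.triple₄
  rw [Finset.mem_Icc] at h1 h2 h3 h4 h5 h6 h7 h8 h9
  simp only [seq, consTriple, List.mem_cons, List.not_mem_nil, or_false] at hβ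
  rcases hβ with rfl | rfl | rfl | rfl | rfl | rfl | rfl | rfl | rfl <;> dsimp only <;> omega

theorem Psi_eq {d : (ℕ × ℕ) →₀ ℕ} (hd : ∀ β ∉ D.seq, d β = 0) :
    (Psi d : ℤ) = ∑ t ∈ Finset.range 7, (t : ℤ) * wt t d :=
  Psi_eq_sum_wt fun β hβ => D.root_of_mem_seq (by_contra fun h => hβ (hd β h))

theorem isInit_colDet {a b c : ℕ} (ha : a ∈ Finset.Icc 1 6) (hb : b ∈ Finset.Icc 1 6)
    (hc : c ∈ Finset.Icc 1 6) (hab : a ≠ b) (hac : a ≠ c) (hbc : b ≠ c) :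
    IsInit (rho D.seq) (colDet D.seq a b c) (D.val {a, b, c})
      (coeff (D.val {a, b, c}) (colDet D.seq a b c)) := by
  obtain ⟨h1, h2⟩ := D.iterSpec.minor a ha b hb c hc
  obtain ⟨h3, h4⟩ := h2 hab hac hbc
  refine ⟨mem_support_iff.1 h3, rfl, fun d hd hne => ?_⟩
  refine rho_lt_iff.2 (Or.inr ⟨?_, h4 d hd hne⟩)
  have h : (Psi (D.val {a, b, c}) : ℤ) = Psi d := by
    rw [D.Psi_eq (h1 _ h3).1, D.Psi_eq (h1 _ hd).1]
    simp only [(h1 _ h3).2, (h1 _ hd).2]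
  exact_mod_cast h

end IterData

/-- The set of columns of a Plücker coordinate. -/
def cols (K : MI 6) : Finset ℕ := {K.1 0, K.1 1, K.1 2}

/-- The weight of a Plücker coordinate for the action of the torus. -/
def colWt (K : MI 6) (t : ℕ) : ℤ := minorWt (K.1 0) (K.1 1) (K.1 2) t

theorem MI.lt (K : MI 6) : K.1 0 < K.1 1 ∧ K.1 1 < K.1 2 :=
  ⟨K.2.1 (by decide), K.2.1 (by decide)⟩

theorem MI.mem_Icc (K : MI 6) (a : Fin 3) : K.1 a ∈ Finset.Icc 1 6 :=
  Finset.mem_Icc.2 (K.2.2 a)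

namespace IterData

variable (D : IterData)

/-- The coefficient of the initial term of the pullback of a Plücker coordinate. -/
noncomputable def lead (K : MI 6) : ℂ := coeff (D.val (cols K)) (phiStar 6 D.seq K.1)

theorem isInit_phiStar (K : MI 6) :
    IsInit (rho D.seq) (phiStar 6 D.seq K.1) (D.val (cols K)) (D.lead K) := by
  obtain ⟨h1, h2⟩ := MI.lt K
  rw [lead, phiStar_eq]
  exact D.isInit_colDet (MI.mem_Icc K 0) (MI.mem_Icc K 1) (MI.mem_Icc K 2) h1.ne (h1.trans h2).ne
    h2.ne

theorem valS_eq (K : MI 6) : valS 6 D.seq K.1 = D.val (cols K) :=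
  minSupp_eq (D.isInit_phiStar K)

/-- The weight of an exponent under the weighting matrix. -/
noncomputable def expo : (MI 6 →₀ ℕ) →+ ((ℕ × ℕ) →₀ ℕ) := expSum fun K => D.val (cols K)

theorem MSdot_eq (m : MI 6 →₀ ℕ) : MSdot 6 D.seq m = D.expo m := by
  simp only [MSdot, valS_eq]
  rfl

theorem expo_single (K : MI 6) : D.expo (Finsupp.single K 1) = D.val (cols K) := by
  rw [expo, expSum_single, one_smul]

theorem val_spec (K : MI 6) : (∀ β ∉ D.seq, D.val (cols K) β = 0) ∧
    ∀ t, wt t (D.val (cols K)) = minorWt (K.1 0) (K.1 1) (K.1 2) t := by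
  obtain ⟨h1, h2⟩ := MI.lt K
  obtain ⟨h3, h4⟩ := D.iterSpec.minor _ (MI.mem_Icc K 0) _ (MI.mem_Icc K 1) _ (MI.mem_Icc K 2)
  exact h3 _ (h4 h1.ne (h1.trans h2).ne h2.ne).1

theorem expo_eq_zero {β : ℕ × ℕ} (hβ : β ∉ D.seq) (m : MI 6 →₀ ℕ) : D.expo m β = 0 := by
  induction m using Finsupp.induction_linear with
  | zero => simp
  | add m m' ih ih' => rw [map_add, Finsupp.add_apply, ih, ih']
  | single K n => rw [expo, expSum_single, Finsupp.smul_apply, (D.val_spec K).1 β hβ, smul_zero]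

theorem wt_expo (t : ℕ) (m : MI 6 →₀ ℕ) : wt t (D.expo m) = Finsupp.weight colWt m t := by
  induction m using Finsupp.induction_linear with
  | zero => simp
  | add m m' ih ih' => rw [map_add, map_add, map_add, ih, ih', Pi.add_apply]
  | single K n =>
    rw [expo, expSum_single, map_nsmul, (D.val_spec K).2, Finsupp.weight_single]
    rfl

/-- The pullback of the Plücker coordinates. -/
noncomputable def pullback : PRing 6 →ₐ[ℂ] MvPolynomial (ℕ × ℕ) ℂ :=
  aeval fun K => phiStar 6 D.seq K.1

/-- The substitution of initial terms of the Plücker coordinates. -/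
noncomputable def toric : PRing 6 →ₐ[ℂ] MvPolynomial (ℕ × ℕ) ℂ :=
  aeval fun K => monomial (D.val (cols K)) (D.lead K)

end IterData

theorem IsIter.exists_isTriple_of_perm {B : List (ℕ × ℕ)} (h : B.Perm [(1, 4), (2, 4), (3, 4)]) :
    ∃ b₁ b₂ b₃, IsTriple 3 b₁ b₂ b₃ ∧ B = consTriple 4 b₁ b₂ b₃ [] := by
  have hn : B.Nodup := h.nodup_iff.2 (by decide)
  have hmem : ∀ β ∈ B, 1 ≤ β.1 ∧ β.1 ≤ 3 ∧ β.2 = 4 := by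
    intro β hβ
    have := h.mem_iff.1 hβ
    simp only [List.mem_cons, List.not_mem_nil, or_false] at this
    rcases this with rfl | rfl | rfl <;> decide
  obtain ⟨⟨b₁, c₁⟩, ⟨b₂, c₂⟩, ⟨b₃, c₃⟩, rfl⟩ := List.length_eq_three.1 h.length_eq
  have h1 := hmem (b₁, c₁) (by simp)
  have h2 := hmem (b₂, c₂) (by simp)
  have h3 := hmem (b₃, c₃) (by simp)
  obtain ⟨h11, h12, rfl⟩ := h1
  obtain ⟨h21, h22, rfl⟩ := h2
  obtain ⟨h31, h32, rfl⟩ := h3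
  simp only [List.nodup_cons, List.mem_cons, Prod.mk.injEq, and_true, List.not_mem_nil, or_false,
    not_or] at hn
  refine ⟨b₁, b₂, b₃, ⟨Finset.mem_Icc.2 ⟨h11, h12⟩, Finset.mem_Icc.2 ⟨h21, h22⟩,
    Finset.mem_Icc.2 ⟨h31, h32⟩, hn.1.1, hn.1.2, hn.2.1⟩, rfl⟩

theorem IsIter.exists_data {i₁ i₂ i₃ j₁ j₂ j₃ : ℕ} {B : List (ℕ × ℕ)}
    (h : IsIter 6 ((i₁,6) :: (i₂,6) :: (i₃,6) :: (j₁,5) :: (j₂,5) :: (j₃,5) :: B)) :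
    ∃ D : IterData, (D.i₁ = i₁ ∧ D.i₂ = i₂ ∧ D.j₁ = j₁ ∧ D.j₂ = j₂) ∧
      (i₁,6) :: (i₂,6) :: (i₃,6) :: (j₁,5) :: (j₂,5) :: (j₃,5) :: B = D.seq := by
  cases h with
  | step _ _ _ _ _ _ h a1 a2 a3 a4 a5 a6 n1 n2 n3 =>
    cases h with
    | step _ _ _ _ _ _ h c1 c2 c3 c4 c5 c6 l1 l2 l3 =>
      cases h with
      | base _ h =>
        obtain ⟨b₁, b₂, b₃, hb, rfl⟩ := exists_isTriple_of_perm h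
        exact ⟨⟨i₁, i₂, i₃, j₁, j₂, j₃, b₁, b₂, b₃,
          ⟨Finset.mem_Icc.2 ⟨a1, a2⟩, Finset.mem_Icc.2 ⟨a3, a4⟩, Finset.mem_Icc.2 ⟨a5, a6⟩,
            n1, n2, n3⟩,
          ⟨Finset.mem_Icc.2 ⟨c1, c2⟩, Finset.mem_Icc.2 ⟨c3, c4⟩, Finset.mem_Icc.2 ⟨c5, c6⟩,
            l1, l2, l3⟩, hb⟩, ⟨rfl, rfl, rfl, rfl⟩, rfl⟩
      | step => omega

/-! ### Plücker relations and the pullback -/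

theorem insert3_eq {I : Fin 2 → ℕ} (hI : I 0 < I 1) (j : ℕ) : insert3 I j =
    if j ≤ I 0 then ![j, I 0, I 1] else if j ≤ I 1 then ![I 0, j, I 1] else ![I 0, I 1, j] := by
  rcases le_or_gt j (I 0) with h | h
  · rcases h.lt_or_eq with h0 | h0
    · funext a
      fin_cases a <;> simp [insert3, List.insertionSort, List.orderedInsert, hI.le, h0.not_ge,
        (h0.trans hI).not_ge, h]
    · subst h0
      funext a
      fin_cases a <;> simp [insert3, List.insertionSort, List.orderedInsert, hI.not_ge]
  · rcases le_or_gt j (I 1) with h' | h'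
    · rcases h'.lt_or_eq with h1 | h1
      · funext a
        fin_cases a <;> simp [insert3, List.insertionSort, List.orderedInsert, h.le, h.not_ge,
          h1.not_ge, h']
      · subst h1
        funext a
        fin_cases a <;> simp [insert3, List.insertionSort, h.le, h.not_ge]
    · funext a
      fin_cases a <;> simp [insert3, List.insertionSort, hI.le, h.not_ge,
        h'.not_ge, h'.le]

theorem erase4_eq {J : Fin 4 → ℕ} (hJ : StrictMono J) (a : Fin 4) :
    erase4 J (J a) = ![![J 1, J 2, J 3], ![J 0, J 2, J 3], ![J 0, J 1, J 3], ![J 0, J 1, J 2]] a := by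
  have h01 : J 0 < J 1 := hJ (by decide)
  have h12 : J 1 < J 2 := hJ (by decide)
  have h23 : J 2 < J 3 := hJ (by decide)
  funext b
  fin_cases a <;> fin_cases b <;>
    simp [erase4, h01.ne, h12.ne, h23.ne, (h01.trans h12).ne,
      (h12.trans h23).ne, (h01.trans (h12.trans h23)).ne]

theorem card_filter_lt {J : Fin 4 → ℕ} (hJ : StrictMono J) (a : Fin 4) :
    (Finset.univ.filter fun b : Fin 4 => J a < J b).card = 3 - a.val := by
  simp only [hJ.lt_iff_lt]
  revert a
  decide

theorem sorted_vec3 {a b c : ℕ} (ha : 1 ≤ a) (hab : a < b) (hbc : b < c) (hc : c ≤ 6) :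
    Sorted 3 6 ![a, b, c] := by
  refine ⟨?_, fun x => ?_⟩
  · rw [Fin.strictMono_iff_lt_succ]
    intro x
    fin_cases x
    exacts [hab, hbc]
  · fin_cases x
    exacts [⟨ha, by simp; omega⟩, ⟨by simp; omega, by simp; omega⟩, ⟨by simp; omega, hc⟩]

namespace IterData

variable (D : IterData)

theorem pullback_pvar {K : Fin 3 → ℕ} (hK : Sorted 3 6 K) :
    D.pullback (pvar 6 K) = colDet D.seq (K 0) (K 1) (K 2) := by
  rw [pvar, dif_pos hK, pullback, aeval_X, phiStar_eq]

theorem pullback_pvar_insert3 {I : Fin 2 → ℕ} (hI : Sorted 2 6 I) {j : ℕ} (hj : j ∈ Finset.Icc 1 6) :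
    (-1) ^ (Finset.univ.filter fun b : Fin 2 => I b < j).card * D.pullback (pvar 6 (insert3 I j)) =
      colDet D.seq j (I 0) (I 1) := by
  have h01 : I 0 < I 1 := hI.1 (by decide)
  have h0 := hI.2 0
  have h1 := hI.2 1
  rw [Finset.mem_Icc] at hj
  rw [insert3_eq h01, Finset.card_filter, Fin.sum_univ_two]
  have hbad : ∀ K : Fin 3 → ℕ, (K 0 = K 1 ∨ K 1 = K 2) → D.pullback (pvar 6 K) = 0 := by
    intro K hK
    rw [pvar, dif_neg, map_zero]
    intro h
    have h2 := h.1 (show (0 : Fin 3) < 1 by decide)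
    have h3 := h.1 (show (1 : Fin 3) < 2 by decide)
    omega
  rcases lt_trichotomy j (I 0) with h | h | h
  · rw [if_pos h.le, D.pullback_pvar (sorted_vec3 hj.1 h h01 h1.2), if_neg h.not_gt,
      if_neg (h.trans h01).not_gt]
    simp
  · rw [if_pos h.le, hbad _ (Or.inl h), h, mul_zero, colDet_swap', colDet_eq_zero (Or.inl rfl),
      neg_zero]
  · rw [if_neg h.not_ge]
    rcases lt_trichotomy j (I 1) with h' | h' | h'
    · rw [if_pos h'.le, D.pullback_pvar (sorted_vec3 h0.1 h h' h1.2), if_pos h, if_neg h'.not_gt,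
        colDet_swap]
      simp
    · rw [if_pos h'.le, hbad _ (Or.inr h'), h', mul_zero, colDet_eq_zero (Or.inl rfl)]
    · rw [if_neg h'.not_ge, D.pullback_pvar (sorted_vec3 h0.1 h01 h' hj.2), if_pos h, if_pos h',
        ← neg_neg (colDet D.seq j _ _), ← colDet_swap, ← colDet_swap']
      simp

theorem pullback_Rrel {I : Fin 2 → ℕ} {J : Fin 4 → ℕ} (hI : Sorted 2 6 I) (hJ : Sorted 4 6 J) :
    D.pullback (Rrel 6 I J) = 0 := by
  have h01 : J 0 < J 1 := hJ.1 (by decide)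
  have h12 : J 1 < J 2 := hJ.1 (by decide)
  have h23 : J 2 < J 3 := hJ.1 (by decide)
  have h0 := (hJ.2 0).1
  have h3 := (hJ.2 3).2
  have key : ∀ a, D.pullback ((-1) ^ ((Finset.univ.filter fun b : Fin 2 => I b < J a).card +
        (Finset.univ.filter fun b : Fin 4 => J a < J b).card) *
      (pvar 6 (insert3 I (J a)) * pvar 6 (erase4 J (J a)))) =
      (-1) ^ (3 - a.val) * (colDet D.seq (J a) (I 0) (I 1) *
        D.pullback (pvar 6 (erase4 J (J a)))) := by
    intro a
    rw [← D.pullback_pvar_insert3 hI (Finset.mem_Icc.2 (hJ.2 a)), card_filter_lt hJ.1]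
    simp only [map_mul, map_pow, map_neg, map_one]
    ring
  rw [Rrel, map_sum, Finset.sum_congr rfl fun a _ => key a, Fin.sum_univ_four]
  simp only [erase4_eq hJ.1]
  simp only [Matrix.cons_val]
  rw [D.pullback_pvar (sorted_vec3 (by omega) h12 h23 h3),
    D.pullback_pvar (sorted_vec3 h0 (h01.trans h12) h23 h3),
    D.pullback_pvar (sorted_vec3 h0 h01 (h12.trans h23) h3),
    D.pullback_pvar (sorted_vec3 h0 h01 h12 (by omega))]
  simp only [colDet_eq, Matrix.cons_val]
  simp
  ring

theorem pullback_eq_zero {f : PRing 6} (hf : f ∈ PluckerIdeal 6) : D.pullback f = 0 := by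
  have h : PluckerIdeal 6 ≤ RingHom.ker D.pullback := by
    refine Ideal.span_le.2 ?_
    rintro _ ⟨I, J, hI, hJ, rfl⟩
    exact D.pullback_Rrel hI hJ
  exact h hf

theorem toric_inM {f : PRing 6} (hf : f ∈ PluckerIdeal 6) : D.toric (inM 6 D.seq f) = 0 := by
  refine aeval_initial_eq_zero D.isInit_phiStar (D.pullback_eq_zero hf) _ fun m => ?_
  classical
  rw [Finset.mem_filter]
  refine and_congr_right fun _ => forall₂_congr fun m' _ => ?_
  rw [D.MSdot_eq, D.MSdot_eq]
  exact rho_le_iff.symm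

/-- In an element of the initial ideal, every term shares its weight with another term. -/
theorem exists_ne_expo_eq {g : PRing 6} (hg : g ∈ InIdeal 6 D.seq) {m : MI 6 →₀ ℕ}
    (hm : m ∈ g.support) : ∃ m' ∈ g.support, m' ≠ m ∧ D.expo m' = D.expo m := by
  have h : InIdeal 6 D.seq ≤ RingHom.ker D.toric := by
    refine Ideal.span_le.2 ?_
    rintro _ ⟨f, hf, -, rfl⟩
    exact D.toric_inM hf
  exact exists_ne_expSum_eq (fun K => (D.isInit_phiStar K).1) (h hg) hm

end IterData

/-! ### Homogeneity of the Plücker ideal -/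

theorem minorWt_swap (a b c : ℕ) : minorWt b a c = minorWt a b c := by
  funext t
  unfold minorWt
  ring

theorem minorWt_swap' (a b c : ℕ) : minorWt a c b = minorWt a b c := by
  funext t
  unfold minorWt
  ring

theorem isWeightedHomogeneous_pvar (K : Fin 3 → ℕ) :
    IsWeightedHomogeneous colWt (pvar 6 K) (minorWt (K 0) (K 1) (K 2)) := by
  by_cases hK : Sorted 3 6 K
  · rw [pvar, dif_pos hK]
    exact isWeightedHomogeneous_X ℂ colWt ⟨K, hK⟩
  · rw [pvar, dif_neg hK]
    exact isWeightedHomogeneous_zero ..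

theorem isWeightedHomogeneous_pvar_insert3 {I : Fin 2 → ℕ} (hI : I 0 < I 1) (j : ℕ) :
    IsWeightedHomogeneous colWt (pvar 6 (insert3 I j)) (minorWt (I 0) (I 1) j) := by
  rw [insert3_eq hI]
  split_ifs
  · rw [← minorWt_swap', ← minorWt_swap]
    exact isWeightedHomogeneous_pvar _
  · rw [← minorWt_swap']
    exact isWeightedHomogeneous_pvar _
  · exact isWeightedHomogeneous_pvar _

theorem isWeightedHomogeneous_Rrel {I : Fin 2 → ℕ} {J : Fin 4 → ℕ} (hI : Sorted 2 6 I)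
    (hJ : Sorted 4 6 J) : IsWeightedHomogeneous colWt (Rrel 6 I J)
      (minorWt (I 0) (I 1) (J 0) + minorWt (J 1) (J 2) (J 3)) := by
  refine IsWeightedHomogeneous.sum _ _ _ fun a _ => ?_
  have hw : minorWt (I 0) (I 1) (J 0) + minorWt (J 1) (J 2) (J 3) =
      minorWt (I 0) (I 1) (J a) +
        minorWt (erase4 J (J a) 0) (erase4 J (J a) 1) (erase4 J (J a) 2) := by
    funext t
    rw [erase4_eq hJ.1]
    fin_cases a <;> simp [minorWt] <;> ring
  have hsign : ∀ k : ℕ, (-1 : PRing 6) ^ k = C ((-1) ^ k) := fun k => by simp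
  rw [hsign, hw]
  exact ((isWeightedHomogeneous_pvar_insert3 (hI.1 (by decide)) _).mul
    (isWeightedHomogeneous_pvar _)).C_mul _

theorem weightedHomogeneousComponent_mem_pluckerIdeal {f : PRing 6} (hf : f ∈ PluckerIdeal 6)
    (w : ℕ → ℤ) : weightedHomogeneousComponent colWt w f ∈ PluckerIdeal 6 := by
  classical
  let _ := weightedGradedAlgebra ℂ colWt
  refine weightedHomogeneousComponent_mem_of_mem ℂ colWt
    (Ideal.homogeneous_span _ _ ?_) hf w
  rintro _ ⟨I, J, hI, hJ, rfl⟩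
  exact ⟨_, isWeightedHomogeneous_Rrel hI hJ⟩

/-! ### The dependence of the weights on the sequence -/

/-- The lexicographic order on quadruples. -/
def Lex4 (x y : ℕ × ℕ × ℕ × ℕ) : Prop :=
  x.1 < y.1 ∨ x.1 = y.1 ∧ (x.2.1 < y.2.1 ∨ x.2.1 = y.2.1 ∧
    (x.2.2.1 < y.2.2.1 ∨ x.2.2.1 = y.2.2.1 ∧ x.2.2.2 < y.2.2.2))

namespace IterData

variable (D D' : IterData)

theorem eq_sum_single {d : (ℕ × ℕ) →₀ ℕ} (hd : ∀ β ∉ D.seq, d β = 0) : d =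
    Finsupp.single (D.i₁, 6) (d (D.i₁, 6)) + Finsupp.single (D.i₂, 6) (d (D.i₂, 6)) +
    Finsupp.single (D.i₃, 6) (d (D.i₃, 6)) + Finsupp.single (D.j₁, 5) (d (D.j₁, 5)) +
    Finsupp.single (D.j₂, 5) (d (D.j₂, 5)) + Finsupp.single (D.j₃, 5) (d (D.j₃, 5)) +
    Finsupp.single (D.b₁, 4) (d (D.b₁, 4)) + Finsupp.single (D.b₂, 4) (d (D.b₂, 4)) +
    Finsupp.single (D.b₃, 4) (d (D.b₃, 4)) := by
  obtain ⟨-, -, -, h1, h2, h3⟩ := D.triple₆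
  obtain ⟨-, -, -, h4, h5, h6⟩ := D.triple₅
  obtain ⟨-, -, -, h7, h8, h9⟩ := D.triple₄
  ext β
  by_cases hβ : β ∈ D.seq
  · simp only [seq, consTriple, List.mem_cons, List.not_mem_nil, or_false] at hβ
    rcases hβ with rfl | rfl | rfl | rfl | rfl | rfl | rfl | rfl | rfl <;>
      simp [*, Ne.symm h1, Ne.symm h2, Ne.symm h3, Ne.symm h4, Ne.symm h5,
        Ne.symm h6, Ne.symm h7, Ne.symm h8, Ne.symm h9]
  · have h0 := hd β hβ
    simp only [seq, consTriple, List.mem_cons, List.not_mem_nil, or_false, not_or] at hβ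
    obtain ⟨h1, h2, h3, h4, h5, h6, h7, h8, h9⟩ := hβ
    simp only [Finsupp.add_apply, Finsupp.single_eq_of_ne h1, Finsupp.single_eq_of_ne h2,
      Finsupp.single_eq_of_ne h3, Finsupp.single_eq_of_ne h4, Finsupp.single_eq_of_ne h5,
      Finsupp.single_eq_of_ne h6, Finsupp.single_eq_of_ne h7, Finsupp.single_eq_of_ne h8,
      Finsupp.single_eq_of_ne h9, h0, add_zero]

/-- The coordinates of an exponent at the first two roots of the columns `6` and `5`. -/
def coords (d : (ℕ × ℕ) →₀ ℕ) : ℕ × ℕ × ℕ × ℕ :=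
  (d (D.i₁, 6), d (D.i₂, 6), d (D.j₁, 5), d (D.j₂, 5))

theorem wt_eq {d : (ℕ × ℕ) →₀ ℕ} (hd : ∀ β ∉ D.seq, d β = 0) (t : ℕ) : wt t d =
    (d (D.i₁, 6) : ℤ) * ((if 6 = t then 1 else 0) - if D.i₁ = t then 1 else 0) +
    (d (D.i₂, 6) : ℤ) * ((if 6 = t then 1 else 0) - if D.i₂ = t then 1 else 0) +
    (d (D.i₃, 6) : ℤ) * ((if 6 = t then 1 else 0) - if D.i₃ = t then 1 else 0) +
    (d (D.j₁, 5) : ℤ) * ((if 5 = t then 1 else 0) - if D.j₁ = t then 1 else 0) +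
    (d (D.j₂, 5) : ℤ) * ((if 5 = t then 1 else 0) - if D.j₂ = t then 1 else 0) +
    (d (D.j₃, 5) : ℤ) * ((if 5 = t then 1 else 0) - if D.j₃ = t then 1 else 0) +
    (d (D.b₁, 4) : ℤ) * ((if 4 = t then 1 else 0) - if D.b₁ = t then 1 else 0) +
    (d (D.b₂, 4) : ℤ) * ((if 4 = t then 1 else 0) - if D.b₂ = t then 1 else 0) +
    (d (D.b₃, 4) : ℤ) * ((if 4 = t then 1 else 0) - if D.b₃ = t then 1 else 0) := by
  conv_lhs => rw [D.eq_sum_single hd]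
  simp only [map_add, wt_single]

theorem wt_six {d : (ℕ × ℕ) →₀ ℕ} (hd : ∀ β ∉ D.seq, d β = 0) :
    wt 6 d = d (D.i₁, 6) + d (D.i₂, 6) + d (D.i₃, 6) := by
  obtain ⟨h1, h2, h3, -⟩ := D.triple₆
  obtain ⟨h4, h5, h6, -⟩ := D.triple₅
  obtain ⟨h7, h8, h9, -⟩ := D.triple₄
  rw [Finset.mem_Icc] at h1 h2 h3 h4 h5 h6 h7 h8 h9
  rw [D.wt_eq hd]
  simp [show D.i₁ ≠ 6 by omega, show D.i₂ ≠ 6 by omega, show D.i₃ ≠ 6 by omega,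
    show D.j₁ ≠ 6 by omega, show D.j₂ ≠ 6 by omega, show D.j₃ ≠ 6 by omega,
    show D.b₁ ≠ 6 by omega, show D.b₂ ≠ 6 by omega, show D.b₃ ≠ 6 by omega]

/-- Exponents of equal torus weight are determined by their coordinates. -/
theorem eq_of_coords_eq {d e : (ℕ × ℕ) →₀ ℕ} (hd : ∀ β ∉ D.seq, d β = 0)
    (he : ∀ β ∉ D.seq, e β = 0) (hw : ∀ t, wt t d = wt t e) (h : D.coords d = D.coords e) :
    d = e := by
  obtain ⟨h1, h2, h3, -⟩ := D.triple₆
  obtain ⟨h4, h5, h6, -⟩ := D.triple₅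
  obtain ⟨h7, h8, h9, n1, n2, n3⟩ := D.triple₄
  rw [Finset.mem_Icc] at h1 h2 h3 h4 h5 h6 h7 h8 h9
  simp only [coords, Prod.mk.injEq] at h
  obtain ⟨e1, e2, e4, e5⟩ := h
  have e3 : d (D.i₃, 6) = e (D.i₃, 6) := by
    have := hw 6
    rw [D.wt_six hd, D.wt_six he] at this
    omega
  have e6 : d (D.j₃, 5) = e (D.j₃, 5) := by
    have := hw 5
    rw [D.wt_eq hd, D.wt_eq he, e1, e2, e3, e4, e5] at this
    simpa [show D.j₁ ≠ 5 by omega, show D.j₂ ≠ 5 by omega, show D.j₃ ≠ 5 by omega,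
      show D.b₁ ≠ 5 by omega, show D.b₂ ≠ 5 by omega, show D.b₃ ≠ 5 by omega] using this
  have e7 : d (D.b₁, 4) = e (D.b₁, 4) := by
    have := hw D.b₁
    rw [D.wt_eq hd, D.wt_eq he, e1, e2, e3, e4, e5, e6] at this
    simpa [show 4 ≠ D.b₁ by omega, n1.symm, n2.symm] using this
  have e8 : d (D.b₂, 4) = e (D.b₂, 4) := by
    have := hw D.b₂
    rw [D.wt_eq hd, D.wt_eq he, e1, e2, e3, e4, e5, e6] at this
    simpa [show 4 ≠ D.b₂ by omega, n1, n3.symm] using this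
  have e9 : d (D.b₃, 4) = e (D.b₃, 4) := by
    have := hw D.b₃
    rw [D.wt_eq hd, D.wt_eq he, e1, e2, e3, e4, e5, e6] at this
    simpa [show 4 ≠ D.b₃ by omega, n2, n3] using this
  rw [D.eq_sum_single hd, D.eq_sum_single he, e1, e2, e3, e4, e5, e6, e7, e8, e9]

theorem psiLE_iff {d e : (ℕ × ℕ) →₀ ℕ} (hd : ∀ β ∉ D.seq, d β = 0)
    (he : ∀ β ∉ D.seq, e β = 0) (hw : ∀ t, wt t d = wt t e) :
    psiLE D.seq d e ↔ ¬ Lex4 (D.coords d) (D.coords e) := by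
  have hP : Psi d = Psi e := by
    have h : (Psi d : ℤ) = Psi e := by
      rw [D.Psi_eq hd, D.Psi_eq he]
      simp only [hw]
    exact_mod_cast h
  refine rho_le_iff.symm.trans (not_lt.symm.trans (not_congr (rho_lt_iff.trans ?_)))
  unfold psiLT
  simp only [hP, lt_irrefl, false_or, true_and]
  have hcoords : D.coords d = D.coords e → d (D.j₃, 5) = e (D.j₃, 5) ∧
      d (D.b₁, 4) = e (D.b₁, 4) ∧ d (D.b₂, 4) = e (D.b₂, 4) ∧ d (D.b₃, 4) = e (D.b₃, 4) := by
    intro h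
    simp [D.eq_of_coords_eq hd he hw h]
  have h6 := hw 6
  rw [D.wt_six hd, D.wt_six he] at h6
  simp only [seq, consTriple, lexLT_cons, not_lexLT_nil, and_false, or_false, Lex4, coords,
    Prod.mk.injEq] at hcoords ⊢
  omega

end IterData

section Vstep

variable {r i₁ i₂ i₃ k : ℕ} {v : Finset ℕ → (ℕ × ℕ) →₀ ℕ} {K : Finset ℕ}

theorem vstep_apply_of_ne {β : ℕ × ℕ} (h : β.2 ≠ r) : vstep r i₁ i₂ i₃ v K β =
    if r ∈ K then
      if i₁ ∉ K then v (insert i₁ (K.erase r)) β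
      else if i₂ ∉ K then v (insert i₂ (K.erase r)) β
      else v (insert i₃ (K.erase r)) β
    else v K β := by
  have hs : ∀ x, Finsupp.single (x, r) 1 β = 0 := fun x =>
    Finsupp.single_eq_of_ne fun hβ => h (by rw [hβ])
  unfold vstep
  split_ifs <;> simp only [Finsupp.add_apply, hs, zero_add]

theorem vstep_apply_first (hi : IsTriple k i₁ i₂ i₃) (hv : ∀ K x, v K (x, r) = 0) :
    vstep r i₁ i₂ i₃ v K (i₁, r) = if r ∈ K ∧ i₁ ∉ K then 1 else 0 := by
  obtain ⟨-, -, -, h1, h2, h3⟩ := hi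
  unfold vstep
  split_ifs <;> simp_all

theorem vstep_apply_second (hi : IsTriple k i₁ i₂ i₃) (hv : ∀ K x, v K (x, r) = 0) :
    vstep r i₁ i₂ i₃ v K (i₂, r) = if r ∈ K ∧ i₁ ∈ K ∧ i₂ ∉ K then 1 else 0 := by
  obtain ⟨-, -, -, h1, h2, h3⟩ := hi
  unfold vstep
  split_ifs <;> simp_all [Ne.symm]

theorem vstep_apply_third (hi : IsTriple k i₁ i₂ i₃) (hv : ∀ K x, v K (x, r) = 0) :
    vstep r i₁ i₂ i₃ v K (i₃, r) = if r ∈ K ∧ i₁ ∈ K ∧ i₂ ∈ K then 1 else 0 := by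
  obtain ⟨-, -, -, h1, h2, h3⟩ := hi
  unfold vstep
  split_ifs <;> simp_all [Ne.symm]

end Vstep

theorem card_cols (K : MI 6) : (cols K).card = 3 := by
  obtain ⟨h1, h2⟩ := MI.lt K
  exact Finset.card_eq_three.2 ⟨_, _, _, h1.ne, (h1.trans h2).ne, h2.ne, rfl⟩

namespace IterData

variable (D D' : IterData)

theorem val₄_apply_five (K : Finset ℕ) (x : ℕ) : D.val₄ K (x, 5) = 0 := by
  rw [val₄, vstep_apply_of_ne (by norm_num)]
  simp

theorem val₅_apply_six (K : Finset ℕ) (x : ℕ) : D.val₅ K (x, 6) = 0 := by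
  rw [val₅, vstep_apply_of_ne (by norm_num)]
  simp [val₄, vstep_apply_of_ne]

open scoped Classical in
theorem coeff_inM (f : PRing 6) (m : MI 6 →₀ ℕ) : coeff m (inM 6 D.seq f) =
    if ∀ m' ∈ f.support, psiLE D.seq (D.expo m) (D.expo m') then coeff m f else 0 := by
  simp only [inM, coeff_sum, coeff_monomial, Finset.sum_ite_eq', Finset.mem_filter, D.MSdot_eq]
  by_cases hm : m ∈ f.support
  · simp [hm]
  · rw [notMem_support_iff.1 hm, ite_self, ite_self]

/-- The first two indices of the iteration triples coincide. -/
structure SameFirst : Prop where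
  i₁ : D.i₁ = D'.i₁
  i₂ : D.i₂ = D'.i₂
  j₁ : D.j₁ = D'.j₁
  j₂ : D.j₂ = D'.j₂

variable {D D'}

theorem SameFirst.symm (h : SameFirst D D') : SameFirst D' D :=
  ⟨h.i₁.symm, h.i₂.symm, h.j₁.symm, h.j₂.symm⟩

theorem SameFirst.val_first (h : SameFirst D D') (K : Finset ℕ) :
    D'.val K (D.i₁, 6) = D.val K (D.i₁, 6) := by
  rw [val, val, vstep_apply_first D.triple₆ D.val₅_apply_six, h.i₁,
    vstep_apply_first D'.triple₆ D'.val₅_apply_six]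

theorem SameFirst.val_second (h : SameFirst D D') (K : Finset ℕ) :
    D'.val K (D.i₂, 6) = D.val K (D.i₂, 6) := by
  rw [val, val, vstep_apply_second D.triple₆ D.val₅_apply_six, h.i₁, h.i₂,
    vstep_apply_second D'.triple₆ D'.val₅_apply_six]

theorem SameFirst.val₅_eq (h : SameFirst D D') {j : ℕ} (hj : j = D.j₁ ∨ j = D.j₂)
    (K : Finset ℕ) : D'.val₅ K (j, 5) = D.val₅ K (j, 5) := by
  rcases hj with rfl | rfl
  · rw [val₅, val₅, vstep_apply_first D.triple₅ D.val₄_apply_five, h.j₁,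
      vstep_apply_first D'.triple₅ D'.val₄_apply_five]
  · rw [val₅, val₅, vstep_apply_second D.triple₅ D.val₄_apply_five, h.j₁, h.j₂,
      vstep_apply_second D'.triple₅ D'.val₄_apply_five]

theorem SameFirst.exists_val_eq (h : SameFirst D D') {j : ℕ} (hj : j = D.j₁ ∨ j = D.j₂) :
    ∃ c : ℤ, ∀ K : Finset ℕ, K.card = 3 →
      (D'.val K (j, 5) : ℤ) = D.val K (j, 5) + c * D.val K (D.i₃, 6) := by
  refine ⟨D.val₅ {D'.i₃, D.i₁, D.i₂} (j, 5) - D.val₅ {D.i₃, D.i₁, D.i₂} (j, 5),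
    fun K hK => ?_⟩
  rw [val, vstep_apply_of_ne (by norm_num), val, vstep_apply_of_ne (by norm_num),
    vstep_apply_third D.triple₆ D.val₅_apply_six]
  simp only [h.val₅_eq hj, ← h.i₁, ← h.i₂]
  split_ifs with h6 h1 h2 <;> first | simp_all; done | skip
  have hK' : K.erase 6 = {D.i₁, D.i₂} := by
    have m1 := Finset.mem_Icc.1 D.triple₆.mem₁
    have m2 := Finset.mem_Icc.1 D.triple₆.mem₂
    refine (Finset.eq_of_subset_of_card_le ?_ ?_).symm
    · intro x hx
      rw [Finset.mem_insert, Finset.mem_singleton] at hx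
      rcases hx with rfl | rfl
      · exact Finset.mem_erase.2 ⟨by omega, h1⟩
      · exact Finset.mem_erase.2 ⟨by omega, h2⟩
    · rw [Finset.card_erase_of_mem h6, hK, Finset.card_pair D.triple₆.ne₁₂]
  rw [hK']
  ring

theorem SameFirst.expo_eq (h : SameFirst D D') {i : ℕ} (hi : i = D.i₁ ∨ i = D.i₂)
    (m : MI 6 →₀ ℕ) : D'.expo m (i, 6) = D.expo m (i, 6) := by
  induction m using Finsupp.induction_linear with
  | zero => simp
  | add m m' ih ih' => simp only [map_add, Finsupp.add_apply, ih, ih']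
  | single K n =>
    simp only [expo, expSum_single, Finsupp.smul_apply]
    rcases hi with rfl | rfl
    · rw [h.val_first]
    · rw [h.val_second]

theorem SameFirst.exists_expo_eq (h : SameFirst D D') {j : ℕ} (hj : j = D.j₁ ∨ j = D.j₂) :
    ∃ c : ℤ, ∀ m : MI 6 →₀ ℕ,
      (D'.expo m (j, 5) : ℤ) = D.expo m (j, 5) + c * D.expo m (D.i₃, 6) := by
  obtain ⟨c, hc⟩ := h.exists_val_eq hj
  refine ⟨c, fun m => ?_⟩
  induction m using Finsupp.induction_linear with
  | zero => simp
  | add m m' ih ih' =>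
    simp only [map_add, Finsupp.add_apply, Nat.cast_add, ih, ih']
    ring
  | single K n =>
    simp only [expo, expSum_single, Finsupp.smul_apply, smul_eq_mul, Nat.cast_mul,
      hc _ (card_cols K)]
    ring

theorem SameFirst.psiLE_iff (h : SameFirst D D') {m m' : MI 6 →₀ ℕ}
    (hw : Finsupp.weight colWt m = Finsupp.weight colWt m') :
    psiLE D'.seq (D'.expo m) (D'.expo m') ↔ psiLE D.seq (D.expo m) (D.expo m') := by
  have h0 : ∀ (E : IterData) (m : MI 6 →₀ ℕ), ∀ β ∉ E.seq, E.expo m β = 0 :=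
    fun E m _ hβ => E.expo_eq_zero hβ m
  have hwt : ∀ (E : IterData) t, wt t (E.expo m) = wt t (E.expo m') := fun E t => by
    rw [E.wt_expo, E.wt_expo, hw]
  rw [D.psiLE_iff (h0 D m) (h0 D m') (hwt D), D'.psiLE_iff (h0 D' m) (h0 D' m') (hwt D')]
  have h6 := hwt D 6
  rw [D.wt_six (h0 D m), D.wt_six (h0 D m')] at h6
  obtain ⟨c, hc⟩ := h.exists_expo_eq (Or.inl rfl)
  obtain ⟨c', hc'⟩ := h.exists_expo_eq (Or.inr rfl)
  have e1 := hc m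
  have e2 := hc m'
  have e3 := hc' m
  have e4 := hc' m'
  simp only [Lex4, coords, ← h.i₁, ← h.i₂, ← h.j₁, ← h.j₂, h.expo_eq (Or.inl rfl),
    h.expo_eq (Or.inr rfl)]
  by_cases hi : D.expo m (D.i₃, 6) = D.expo m' (D.i₃, 6)
  · rw [hi] at e1 e3
    omega
  · omega

/-- Passing to the torus weight of a minimal term makes the initial form independent of the last
indices. -/
theorem SameFirst.exists_inM_eq (h : SameFirst D D') {f : PRing 6} (hf : f ∈ PluckerIdeal 6)
    (hf0 : f ≠ 0) : ∃ g ∈ PluckerIdeal 6, g ≠ 0 ∧ inM 6 D.seq f = inM 6 D'.seq g := by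
  classical
  obtain ⟨m₀, hm₀, hmin⟩ := f.support.exists_min_image (fun m => rho D.seq (D.expo m))
    (support_nonempty.2 hf0)
  set g := weightedHomogeneousComponent colWt (Finsupp.weight colWt m₀) f with hg
  have hcoeff : ∀ m, coeff m g =
      if Finsupp.weight colWt m = Finsupp.weight colWt m₀ then coeff m f else 0 := fun m =>
    coeff_weightedHomogeneousComponent ..
  have hsupp : ∀ m, m ∈ g.support ↔
      Finsupp.weight colWt m = Finsupp.weight colWt m₀ ∧ m ∈ f.support := fun m => by
    rw [mem_support_iff, hcoeff]
    simp
  refine ⟨g, weightedHomogeneousComponent_mem_pluckerIdeal hf _,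
    support_nonempty.1 ⟨m₀, (hsupp m₀).2 ⟨rfl, hm₀⟩⟩, ?_⟩
  ext m
  by_cases hw : Finsupp.weight colWt m = Finsupp.weight colWt m₀
  · rw [coeff_inM, coeff_inM, hcoeff, if_pos hw]
    congr 1
    refine propext ⟨fun H m' hm' => ?_, fun H m' hm' => ?_⟩
    · obtain ⟨h1, h2⟩ := (hsupp m').1 hm'
      exact (h.psiLE_iff (hw.trans h1.symm)).2 (H m' h2)
    · have := (h.psiLE_iff hw).1 (H m₀ ((hsupp m₀).2 ⟨rfl, hm₀⟩))
      exact rho_le_iff.1 ((rho_le_iff.2 this).trans (hmin m' hm'))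
  · rw [coeff_inM, coeff_inM, hcoeff, if_neg hw, ite_self]
    by_cases hm : m ∈ f.support
    · refine if_neg fun H => hw ?_
      have he : D.expo m = D.expo m₀ := eq_of_rho_eq (fun β hβ => D.expo_eq_zero hβ m)
        (fun β hβ => D.expo_eq_zero hβ m₀)
        (le_antisymm (rho_le_iff.2 (H m₀ hm₀)) (hmin m hm))
      funext t
      rw [← D.wt_expo, ← D.wt_expo, he]
    · rw [notMem_support_iff.1 hm, ite_self]

theorem SameFirst.inIdeal_le (h : SameFirst D D') : InIdeal 6 D.seq ≤ InIdeal 6 D'.seq := by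
  refine Ideal.span_le.2 ?_
  rintro _ ⟨f, hf, hf0, rfl⟩
  obtain ⟨g, hg, hg0, hfg⟩ := h.exists_inM_eq hf hf0
  exact Ideal.subset_span ⟨g, hg, hg0, hfg⟩

theorem SameFirst.inIdeal_eq (h : SameFirst D D') : InIdeal 6 D.seq = InIdeal 6 D'.seq :=
  le_antisymm h.inIdeal_le h.symm.inIdeal_le

end IterData

/-! ### Separating initial ideals -/

namespace IterData

variable {D D' : IterData}

theorem inM_mem_inIdeal {f : PRing 6} (hf : f ∈ PluckerIdeal 6) (hf0 : f ≠ 0) :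
    inM 6 D.seq f ∈ InIdeal 6 D.seq :=
  Ideal.subset_span ⟨f, hf, hf0, rfl⟩

theorem support_inM_subset (f : PRing 6) : (inM 6 D.seq f).support ⊆ f.support := by
  classical
  intro m hm
  rw [mem_support_iff, coeff_inM] at hm
  exact mem_support_iff.2 (ite_ne_right_iff.1 hm).2

theorem inM_ne_zero {f : PRing 6} (hf0 : f ≠ 0) : inM 6 D.seq f ≠ 0 := by
  obtain ⟨m, hm, hmin⟩ := f.support.exists_min_image (fun m => rho D.seq (D.expo m))
    (support_nonempty.2 hf0)
  refine ne_zero_iff.2 ⟨m, ?_⟩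
  rw [coeff_inM, if_pos fun m' hm' => rho_le_iff.1 (hmin m' hm')]
  exact mem_support_iff.1 hm

/-- A trinomial in the Plücker ideal separates initial ideals when the weights single out
different terms. -/
theorem inIdeal_ne_of_trinomial {m₁ m₂ m₃ : MI 6 →₀ ℕ} {c₁ c₂ c₃ : ℂ} (hc : c₁ ≠ 0)
    (hf : monomial m₁ c₁ + monomial m₂ c₂ + monomial m₃ c₃ ∈ PluckerIdeal 6)
    (h₁₂ : D.expo m₁ ≠ D.expo m₂) (h₁₃ : D.expo m₁ ≠ D.expo m₃)
    (h₂₁ : D'.expo m₂ ≠ D'.expo m₁) (h₂₃ : D'.expo m₂ ≠ D'.expo m₃) :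
    InIdeal 6 D.seq ≠ InIdeal 6 D'.seq := by
  classical
  intro hI
  set f := monomial m₁ c₁ + monomial m₂ c₂ + monomial m₃ c₃ with hfdef
  have hf0 : f ≠ 0 := by
    refine ne_zero_iff.2 ⟨m₁, ?_⟩
    have n2 : m₂ ≠ m₁ := fun h => h₁₂ (by rw [h])
    have n3 : m₃ ≠ m₁ := fun h => h₁₃ (by rw [h])
    simpa [hfdef, coeff_monomial, n2, n3] using hc
  set g := inM 6 D.seq f
  have hg : g ∈ InIdeal 6 D.seq := inM_mem_inIdeal hf hf0
  have hg' : g ∈ InIdeal 6 D'.seq := hI ▸ hg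
  have hsupp : ∀ m ∈ g.support, m = m₁ ∨ m = m₂ ∨ m = m₃ := by
    intro m hm
    have := mem_support_iff.1 (support_inM_subset f hm)
    by_contra! h
    simp [hfdef, coeff_monomial, h.1.symm, h.2.1.symm, h.2.2.symm] at this
  have h1 : m₁ ∉ g.support := fun h => by
    obtain ⟨m, hm, hne, he⟩ := D.exists_ne_expo_eq hg h
    rcases hsupp m hm with rfl | rfl | rfl
    exacts [hne rfl, h₁₂ he.symm, h₁₃ he.symm]
  have h2 : m₂ ∉ g.support := fun h => by
    obtain ⟨m, hm, hne, he⟩ := D'.exists_ne_expo_eq hg' h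
    rcases hsupp m hm with rfl | rfl | rfl
    exacts [h₂₁ he.symm, hne rfl, h₂₃ he.symm]
  have h3 : ∀ m ∈ g.support, m = m₃ := fun m hm => by
    rcases hsupp m hm with rfl | rfl | h
    exacts [absurd hm h1, absurd hm h2, h]
  obtain ⟨m, hm⟩ := support_nonempty.2 (inM_ne_zero (D := D) hf0)
  obtain ⟨m', hm', hne, -⟩ := D.exists_ne_expo_eq hg hm
  exact hne ((h3 m' hm').trans (h3 m hm).symm)

/-- For column sets in `{1, …, r}` that contain `a` whenever they contain `r`, the exponent of
`x_{(p, r)}` records whether `r` gets replaced by `p`. -/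
def Pivot (D : IterData) (r a p : ℕ) : Prop :=
  ∀ K : Finset ℕ, (∀ x ∈ K, x ≤ r) → (r ∈ K → a ∈ K) →
    D.val K (p, r) = if r ∈ K ∧ p ∉ K then 1 else 0

theorem val_of_le_five {K : Finset ℕ} (hK : ∀ x ∈ K, x ≤ 5) : D.val K = D.val₅ K :=
  if_neg fun h => absurd (hK 6 h) (by norm_num)

variable (D)

theorem pivot_six_first (a : ℕ) : D.Pivot 6 a D.i₁ := fun _ _ _ =>
  vstep_apply_first D.triple₆ D.val₅_apply_six

theorem pivot_six_second : D.Pivot 6 D.i₁ D.i₂ := fun K _ ha => by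
  rw [val, vstep_apply_second D.triple₆ D.val₅_apply_six]
  exact if_congr (by tauto) rfl rfl

theorem pivot_five_first (a : ℕ) : D.Pivot 5 a D.j₁ := fun K hK _ => by
  rw [val_of_le_five hK]
  exact vstep_apply_first D.triple₅ D.val₄_apply_five

theorem pivot_five_second : D.Pivot 5 D.j₁ D.j₂ := fun K hK ha => by
  rw [val_of_le_five hK, val₅, vstep_apply_second D.triple₅ D.val₄_apply_five]
  exact if_congr (by tauto) rfl rfl

variable {D}

theorem pvar_insert3_of_mem {I : Fin 2 → ℕ} (hI : I 0 < I 1) : pvar 6 (insert3 I (I 0)) = 0 := by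
  refine dif_neg fun h => ?_
  have := h.1 (show (0 : Fin 3) < 1 by decide)
  simp [insert3_eq hI] at this

theorem exists_pvar_insert3_eq {a j r : ℕ} (ha : 1 ≤ a) (hj : 1 ≤ j) (har : a < r) (hjr : j < r)
    (hr : r ≤ 6) (haj : a ≠ j) :
    ∃ K : MI 6, pvar 6 (insert3 ![a, r] j) = X K ∧ cols K = {a, j, r} := by
  have hI : (![a, r] : Fin 2 → ℕ) 0 < (![a, r] : Fin 2 → ℕ) 1 := har
  rw [insert3_eq hI]
  simp only [Matrix.cons_val_zero, Matrix.cons_val_one, hjr.le, if_true]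
  split_ifs with h
  · have hs : Sorted 3 6 ![j, a, r] := sorted_vec3 hj (by omega) har hr
    exact ⟨⟨_, hs⟩, dif_pos hs, by ext; simp [cols]; tauto⟩
  · have hs : Sorted 3 6 ![a, j, r] := sorted_vec3 ha (by omega) hjr hr
    exact ⟨⟨_, hs⟩, dif_pos hs, by ext; simp [cols]⟩

theorem exists_pvar_erase4_eq {J : Fin 4 → ℕ} (hJ : Sorted 4 6 J) (b : Fin 4) :
    ∃ L : MI 6, pvar 6 (erase4 J (J b)) = X L ∧ ∀ x ∈ cols L, x ≤ J 3 := by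
  have h01 : J 0 < J 1 := hJ.1 (by decide)
  have h12 : J 1 < J 2 := hJ.1 (by decide)
  have h23 : J 2 < J 3 := hJ.1 (by decide)
  have key : ∀ u v w, 1 ≤ u → u < v → v < w → w ≤ J 3 →
      ∃ L : MI 6, pvar 6 ![u, v, w] = X L ∧ ∀ x ∈ cols L, x ≤ J 3 := by
    intro u v w hu huv hvw hw
    have hs : Sorted 3 6 ![u, v, w] := sorted_vec3 hu huv hvw (hw.trans (hJ.2 3).2)
    refine ⟨⟨_, hs⟩, dif_pos hs, fun x hx => ?_⟩
    simp [cols] at hx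
    omega
  rw [erase4_eq hJ.1]
  fin_cases b
  · exact key _ _ _ (hJ.2 1).1 h12 h23 le_rfl
  · exact key _ _ _ (hJ.2 0).1 (h01.trans h12) h23 le_rfl
  · exact key _ _ _ (hJ.2 0).1 h01 (h12.trans h23) le_rfl
  · exact key _ _ _ (hJ.2 0).1 h01 h12 h23.le

/-- The terms of the Plücker relation for `I = (a, r)` and a set `J ⊆ {1, …, r - 1}` containing
`a`. -/
theorem exists_Rrel_term {r : ℕ} (hr : r ≤ 6) {J : Fin 4 → ℕ} (hJ : Sorted 4 6 J) (hJr : J 3 < r)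
    {x b : Fin 4} (hb : b ≠ x) : ∃ m : MI 6 →₀ ℕ,
      pvar 6 (insert3 ![J x, r] (J b)) * pvar 6 (erase4 J (J b)) = monomial m 1 ∧
      ∀ (D : IterData) (p : ℕ), D.Pivot r (J x) p → p ≠ J x → p < r →
        D.expo m (p, r) = if p = J b then 0 else 1 := by
  have hlt : ∀ c, J c < r := fun c => (hJ.1.monotone (Fin.le_last c)).trans_lt hJr
  obtain ⟨K, hK, hKc⟩ := exists_pvar_insert3_eq (hJ.2 x).1 (hJ.2 b).1 (hlt x) (hlt b) hr
    (hJ.1.injective.ne hb.symm)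
  obtain ⟨L, hL, hLc⟩ := exists_pvar_erase4_eq hJ b
  refine ⟨Finsupp.single K 1 + Finsupp.single L 1, ?_, fun D p hp hpx hpr => ?_⟩
  · rw [hK, hL, X, X, monomial_mul, one_mul]
  · have hrL : r ∉ cols L := fun h => (hJr.trans_le (hLc r h)).false
    rw [map_add, expo_single, expo_single, Finsupp.add_apply,
      hp _ (fun x hx => ((hLc x hx).trans_lt hJr).le) (fun h => absurd h hrL), hKc,
      hp _ (by simp [(hlt x).le, (hlt b).le]) (by simp)]
    by_cases hpb : p = J b <;> simp [hrL, hpx, hpb, hpr.ne]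

theorem exists_sorted_of_mem {r a p p' : ℕ} (hr : 5 ≤ r) (hr' : r ≤ 6)
    (ha : a ∈ Finset.Icc 1 (r - 1)) (hp : p ∈ Finset.Icc 1 (r - 1))
    (hp' : p' ∈ Finset.Icc 1 (r - 1)) :
    ∃ J : Fin 4 → ℕ, Sorted 4 6 J ∧ J 3 < r ∧ ∃ x y z, J x = a ∧ J y = p ∧ J z = p' := by
  obtain ⟨s, hs, hs', hcard⟩ := Finset.exists_subsuperset_card_eq
    (s := {a, p, p'}) (t := Finset.Icc 1 (r - 1)) (n := 4)
    (by simp [Finset.insert_subset_iff, ha, hp, hp'])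
    (Finset.card_le_three.trans (by norm_num)) (by rw [Nat.card_Icc]; omega)
  have hmem : ∀ x, s.orderEmbOfFin hcard x ∈ Finset.Icc 1 (r - 1) := fun x =>
    hs' (s.orderEmbOfFin_mem hcard x)
  have hsurj : ∀ q ∈ ({a, p, p'} : Finset ℕ), ∃ x, s.orderEmbOfFin hcard x = q := fun q hq => by
    have : q ∈ Set.range (s.orderEmbOfFin hcard) := by
      rw [Finset.range_orderEmbOfFin]
      exact hs hq
    exact this
  obtain ⟨x, hx⟩ := hsurj a (by simp)
  obtain ⟨y, hy⟩ := hsurj p (by simp)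
  obtain ⟨z, hz⟩ := hsurj p' (by simp)
  refine ⟨s.orderEmbOfFin hcard, ⟨(s.orderEmbOfFin hcard).strictMono, fun c => ?_⟩, ?_,
    x, y, z, hx, hy, hz⟩
  · have := Finset.mem_Icc.1 (hmem c)
    omega
  · have := Finset.mem_Icc.1 (hmem 3)
    omega

theorem eq_of_pivot {r a p p' : ℕ} (hr : 5 ≤ r) (hr' : r ≤ 6) (ha : a ∈ Finset.Icc 1 (r - 1))
    (hp : p ∈ Finset.Icc 1 (r - 1)) (hp' : p' ∈ Finset.Icc 1 (r - 1)) (hpa : p ≠ a)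
    (hpa' : p' ≠ a) (h : D.Pivot r a p) (h' : D'.Pivot r a p')
    (hI : InIdeal 6 D.seq = InIdeal 6 D'.seq) : p = p' := by
  by_contra hne
  obtain ⟨J, hJ, hJr, x, y, z, rfl, rfl, rfl⟩ := exists_sorted_of_mem hr hr' ha hp hp'
  have hyx : y ≠ x := fun h => hpa (by rw [h])
  have hzx : z ≠ x := fun h => hpa' (by rw [h])
  have hyz : y ≠ z := fun h => hne (by rw [h])
  obtain ⟨w, hwx, hwy, hwz, hu⟩ : ∃ w, w ≠ x ∧ w ≠ y ∧ w ≠ z ∧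
      (Finset.univ : Finset (Fin 4)) = {x, y, z, w} := by
    clear * - hyx hzx hyz
    revert x y z
    decide
  have hlt : ∀ c, J c < r := fun c => (hJ.1.monotone (Fin.le_last c)).trans_lt hJr
  obtain ⟨m₁, e₁, v₁⟩ := exists_Rrel_term hr' hJ hJr hyx
  obtain ⟨m₂, e₂, v₂⟩ := exists_Rrel_term hr' hJ hJr hzx
  obtain ⟨m₃, e₃, v₃⟩ := exists_Rrel_term hr' hJ hJr hwx
  have hI2 : Sorted 2 6 ![J x, r] := by
    refine ⟨Fin.strictMono_iff_lt_succ.2 fun c => ?_, fun c => ?_⟩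
    · fin_cases c
      exact hlt x
    · fin_cases c
      · exact hJ.2 x
      · exact ⟨by dsimp; omega, hr'⟩
  have hR : Rrel 6 ![J x, r] J ∈ PluckerIdeal 6 := Ideal.subset_span ⟨_, _, hI2, hJ, rfl⟩
  have h0 : pvar 6 (insert3 ![J x, r] (J x)) = 0 :=
    pvar_insert3_of_mem (I := ![J x, r]) (hlt x)
  have hsign : ∀ k : ℕ, (-1 : PRing 6) ^ k = C ((-1) ^ k) := fun k => by simp
  rw [Rrel, hu, Finset.sum_insert (by simp [hyx.symm, hzx.symm, hwx.symm]),
    Finset.sum_insert (by simp [hyz, hwy.symm]), Finset.sum_insert (by simp [hwz.symm]),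
    Finset.sum_singleton, h0, e₁, e₂, e₃, zero_mul, mul_zero, zero_add, ← add_assoc] at hR
  simp only [hsign, C_mul_monomial] at hR
  have hsep : ∀ {E : IterData} {q : ℕ} {m m' : MI 6 →₀ ℕ} {k k' : ℕ},
      E.expo m (q, r) = (if q = k then 0 else 1) → E.expo m' (q, r) = (if q = k' then 0 else 1) →
      q = k → q ≠ k' → E.expo m ≠ E.expo m' := by
    intro E q m m' k k' h1 h2 hk hk' he
    rw [he, h2, if_neg hk', if_pos hk] at h1
    exact one_ne_zero h1
  have w₁ := v₁ D _ h hpa (hlt y)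
  have w₂ := v₂ D' _ h' hpa' (hlt z)
  exact inIdeal_ne_of_trinomial (by simp) hR (hsep w₁ (v₂ D _ h hpa (hlt y)) rfl hne)
    (hsep w₁ (v₃ D _ h hpa (hlt y)) rfl (hJ.1.injective.ne hwy.symm))
    (hsep w₂ (v₁ D' _ h' hpa' (hlt z)) rfl (Ne.symm hne))
    (hsep w₂ (v₃ D' _ h' hpa' (hlt z)) rfl (hJ.1.injective.ne hwz.symm)) hI

theorem sameFirst_of_inIdeal_eq (hI : InIdeal 6 D.seq = InIdeal 6 D'.seq) : SameFirst D D' := by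
  have avoid : ∀ r, 5 ≤ r → ∀ p p', ∃ a ∈ Finset.Icc 1 (r - 1), p ≠ a ∧ p' ≠ a := by
    intro r hr p p'
    obtain ⟨a, ha, hn⟩ := Finset.exists_mem_notMem_of_card_lt_card
      (s := {p, p'}) (t := Finset.Icc 1 (r - 1))
      (Finset.card_le_two.trans_lt (by rw [Nat.card_Icc]; omega))
    simp only [Finset.mem_insert, Finset.mem_singleton, not_or] at hn
    exact ⟨a, ha, Ne.symm hn.1, Ne.symm hn.2⟩
  have t₆ := D.triple₆
  have t₆' := D'.triple₆
  have t₅ := D.triple₅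
  have t₅' := D'.triple₅
  have hi₁ : D.i₁ = D'.i₁ := by
    obtain ⟨a, ha, h1, h2⟩ := avoid 6 (by norm_num) D.i₁ D'.i₁
    exact eq_of_pivot (by norm_num) le_rfl ha t₆.mem₁ t₆'.mem₁ h1 h2 (D.pivot_six_first a)
      (D'.pivot_six_first a) hI
  have hj₁ : D.j₁ = D'.j₁ := by
    obtain ⟨a, ha, h1, h2⟩ := avoid 5 le_rfl D.j₁ D'.j₁
    exact eq_of_pivot le_rfl (by norm_num) ha t₅.mem₁ t₅'.mem₁ h1 h2 (D.pivot_five_first a)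
      (D'.pivot_five_first a) hI
  exact ⟨hi₁, eq_of_pivot (by norm_num) le_rfl t₆.mem₁ t₆.mem₂ t₆'.mem₂ t₆.ne₁₂.symm
      (hi₁ ▸ t₆'.ne₁₂.symm) D.pivot_six_second (hi₁ ▸ D'.pivot_six_second) hI, hj₁,
    eq_of_pivot le_rfl (by norm_num) t₅.mem₁ t₅.mem₂ t₅'.mem₂ t₅.ne₁₂.symm
      (hj₁ ▸ t₅'.ne₁₂.symm) D.pivot_five_second (hj₁ ▸ D'.pivot_five_second) hI⟩

end IterData

/-- Two iterated sequences for `Gr(3,6)` give the same initial ideal if and only if the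
first two indices used in each iteration coincide. -/
theorem initial_ideal_eq_iff (i₁ i₂ i₃ j₁ j₂ j₃ i₁' i₂' i₃' j₁' j₂' j₃' : ℕ)
    (B B' : List (ℕ × ℕ))
    (h₁ : IsIter 6 ((i₁,6) :: (i₂,6) :: (i₃,6) :: (j₁,5) :: (j₂,5) :: (j₃,5) :: B))
    (h₂ : IsIter 6 ((i₁',6) :: (i₂',6) :: (i₃',6) :: (j₁',5) :: (j₂',5) :: (j₃',5) :: B')) :
    InIdeal 6 ((i₁,6) :: (i₂,6) :: (i₃,6) :: (j₁,5) :: (j₂,5) :: (j₃,5) :: B) =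
      InIdeal 6 ((i₁',6) :: (i₂',6) :: (i₃',6) :: (j₁',5) :: (j₂',5) :: (j₃',5) :: B') ↔
    (i₁ = i₁' ∧ i₂ = i₂' ∧ j₁ = j₁' ∧ j₂ = j₂') := by
  obtain ⟨D, ⟨rfl, rfl, rfl, rfl⟩, hS⟩ := h₁.exists_data
  obtain ⟨D', ⟨rfl, rfl, rfl, rfl⟩, hS'⟩ := h₂.exists_data
  rw [hS, hS']
  refine ⟨fun h => ?_, fun ⟨e₁, e₂, e₃, e₄⟩ => IterData.SameFirst.inIdeal_eq ⟨e₁, e₂, e₃, e₄⟩⟩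
  obtain ⟨e₁, e₂, e₃, e₄⟩ := IterData.sameFirst_of_inIdeal_eq h
  exact ⟨e₁, e₂, e₃, e₄⟩
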